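/- arXiv:1701.05977 — 7 statements merged into one kernel-verified Lean document; each statement's English description precedes it below -/
import Mathlib

section
/- Let (f, D) be a solution of f'' = λ·f·m in integral form on I = (a,∞) with λ > 0, and suppose f is positive and nonincreasing on (a,∞). Then for every x ∈ (a,∞) one has ∫_{(x,∞)} f dm < ∞, lim_{y→∞} D(y) = 0, and D(x) = −λ ∫_{(x,∞)} f(y) m(dy). -/
open MeasureTheory Filter Set

/-- A pair `(f, D)` is a solution of `f'' = λ·f·m` in integral form on `S`:
`f y − f x = ∫_x^y D(t) dt` and `D y − D x = λ ∫_{(x,y]} f dm` for all `x ≤ y` in `S`. -/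
def IsIntegralSolution (m : MeasureTheory.Measure ℝ) (lam : ℝ) (S : Set ℝ)
    (f D : ℝ → ℝ) : Prop :=
  (∀ x ∈ S, ∀ y ∈ S, x ≤ y → f y - f x = ∫ t in x..y, D t) ∧
  (∀ x ∈ S, ∀ y ∈ S, x ≤ y → D y - D x = lam * ∫ t in Set.Ioc x y, f t ∂m)

theorem IsIntegralSolution.monotoneOn_deriv {m : Measure ℝ} {a lam : ℝ} (hlam : 0 < lam)
    {f D : ℝ → ℝ} (hsol : IsIntegralSolution m lam (Ioi a) f D)
    (hpos : ∀ x ∈ Ioi a, 0 < f x) : MonotoneOn D (Ioi a) := by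
  intro x hx y hy hxy
  have h : 0 ≤ ∫ t in Ioc x y, f t ∂m :=
    setIntegral_nonneg measurableSet_Ioc fun t ht => (hpos t (lt_trans hx ht.1)).le
  have := hsol.2 x hx y hy hxy
  nlinarith [mul_nonneg hlam.le h]

theorem IsIntegralSolution.mul_le_sub {m : Measure ℝ} {a lam : ℝ} (hlam : 0 < lam)
    {f D : ℝ → ℝ} (hsol : IsIntegralSolution m lam (Ioi a) f D)
    (hpos : ∀ x ∈ Ioi a, 0 < f x) {x y : ℝ} (hx : a < x) (hxy : x ≤ y) :
    D x * (y - x) ≤ f y - f x ∧ f y - f x ≤ D y * (y - x) := by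
  have hmono := hsol.monotoneOn_deriv hlam hpos
  have hy : a < y := hx.trans_le hxy
  have hmem : ∀ t ∈ Icc x y, t ∈ Ioi a := fun t ht => hx.trans_le ht.1
  have hint : IntervalIntegrable D volume x y :=
    MonotoneOn.intervalIntegrable (hmono.mono (by rw [uIcc_of_le hxy]; exact hmem))
  rw [hsol.1 x hx y hy hxy]
  constructor
  · have := intervalIntegral.integral_mono_on hxy intervalIntegrable_const hint
      fun t ht => hmono hx (hmem t ht) ht.1
    rw [intervalIntegral.integral_const, smul_eq_mul] at this
    linarith
  · have := intervalIntegral.integral_mono_on hxy hint intervalIntegrable_const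
      fun t ht => hmono (hmem t ht) hy ht.2
    rw [intervalIntegral.integral_const, smul_eq_mul] at this
    linarith

theorem IsIntegralSolution.deriv_nonpos {m : Measure ℝ} {a lam : ℝ} (hlam : 0 < lam)
    {f D : ℝ → ℝ} (hsol : IsIntegralSolution m lam (Ioi a) f D)
    (hpos : ∀ x ∈ Ioi a, 0 < f x) (hanti : AntitoneOn f (Ioi a)) {x : ℝ} (hx : a < x) :
    D x ≤ 0 := by
  have hxy : x ≤ x + 1 := by linarith
  have h := (hsol.mul_le_sub hlam hpos hx hxy).1
  have h' := hanti hx (hx.trans_le hxy) hxy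
  linarith

theorem IsIntegralSolution.tendsto_deriv {m : Measure ℝ} {a lam : ℝ} (hlam : 0 < lam)
    {f D : ℝ → ℝ} (hsol : IsIntegralSolution m lam (Ioi a) f D)
    (hpos : ∀ x ∈ Ioi a, 0 < f x) (hanti : AntitoneOn f (Ioi a)) :
    Tendsto D atTop (nhds 0) := by
  rw [tendsto_order]
  constructor
  · intro b hb
    have hx : a < a + 1 := by linarith
    have hq : 0 < f (a + 1) / -b := div_pos (hpos _ hx) (by linarith)
    set y := a + 1 + f (a + 1) / -b with hy
    have hxy : a + 1 ≤ y := by linarith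
    have hay : a < y := by linarith
    have hby : b < D y := by
      by_contra! hcon
      have h := (hsol.mul_le_sub hlam hpos hx hxy).2
      have h1 : y - (a + 1) = f (a + 1) / -b := by rw [hy]; ring
      have h2 : b * (f (a + 1) / -b) = -f (a + 1) := by field_simp [hb.ne]
      rw [h1] at h
      have h3 := mul_le_mul_of_nonneg_right hcon hq.le
      have h4 := hpos y hay
      linarith
    filter_upwards [eventually_ge_atTop y] with z hz
    exact hby.trans_le (hsol.monotoneOn_deriv hlam hpos hay (hay.trans_le hz) hz)
  · intro b hb
    filter_upwards [eventually_gt_atTop a] with z hz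
    exact (hsol.deriv_nonpos hlam hpos hanti hz).trans_lt hb

theorem IsIntegralSolution.integrableOn_Ioi {m : Measure ℝ} {a lam : ℝ} (hlam : 0 < lam)
    (hm : ∀ K : Set ℝ, IsCompact K → K ⊆ Ioi a → m K < ⊤)
    {f D : ℝ → ℝ} (hsol : IsIntegralSolution m lam (Ioi a) f D)
    (hpos : ∀ x ∈ Ioi a, 0 < f x) (hanti : AntitoneOn f (Ioi a)) {x : ℝ} (hx : a < x) :
    IntegrableOn f (Ioi x) m := by
  refine integrableOn_Ioi_of_intervalIntegral_norm_bounded (-D x / lam) x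
    (b := fun y : ℝ => y) (l := atTop) (fun y => ?_) tendsto_id ?_
  · rcases le_total x y with hxy | hxy
    · have hsub : Icc x y ⊆ Ioi a := fun t ht => hx.trans_le ht.1
      exact ((hanti.mono hsub).integrableOn_of_measure_ne_top (isLeast_Icc hxy)
        (isGreatest_Icc hxy) (hm _ isCompact_Icc hsub).ne measurableSet_Icc).mono_set
        Ioc_subset_Icc_self
    · simp [Ioc_eq_empty_of_le hxy]
  · filter_upwards [eventually_ge_atTop x] with y hxy
    have hay : a < y := hx.trans_le hxy
    have h : ∫ t in x..y, ‖f t‖ ∂m = ∫ t in Ioc x y, f t ∂m := by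
      rw [intervalIntegral.integral_of_le hxy]
      exact setIntegral_congr_fun measurableSet_Ioc fun t ht =>
        Real.norm_of_nonneg (hpos t (hx.trans ht.1)).le
    rw [h, le_div_iff₀ hlam]
    have h1 := hsol.2 x hx y hay hxy
    have h2 := hsol.deriv_nonpos hlam hpos hanti hay
    linarith

/-- For a positive nonincreasing solution of `f'' = λ·f·m` on `(a,∞)` with `λ > 0`:
`f` is `m`-integrable on every `(x,∞)`, `D(y) → 0` as `y → ∞`, and
`D(x) = −λ ∫_{(x,∞)} f dm`. -/
theorem integral_solution_decreasing_derivative_formula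
    (m : MeasureTheory.Measure ℝ) (a lam : ℝ) (hlam : 0 < lam)
    (hm : ∀ K : Set ℝ, IsCompact K → K ⊆ Set.Ioi a → m K < ⊤)
    (f D : ℝ → ℝ)
    (hsol : IsIntegralSolution m lam (Set.Ioi a) f D)
    (hpos : ∀ x ∈ Set.Ioi a, 0 < f x)
    (hanti : AntitoneOn f (Set.Ioi a)) :
    (∀ x ∈ Set.Ioi a, MeasureTheory.IntegrableOn f (Set.Ioi x) m) ∧
      Filter.Tendsto D Filter.atTop (nhds 0) ∧
      ∀ x ∈ Set.Ioi a, D x = -(lam * ∫ y in Set.Ioi x, f y ∂m) := by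
  have hlim := hsol.tendsto_deriv hlam hpos hanti
  refine ⟨fun x hx => hsol.integrableOn_Ioi hlam hm hpos hanti hx, hlim, fun x hx => ?_⟩
  have h1 : Tendsto (fun y => lam * ∫ t in x..y, f t ∂m) atTop
      (nhds (lam * ∫ t in Ioi x, f t ∂m)) :=
    (intervalIntegral_tendsto_integral_Ioi x
      (hsol.integrableOn_Ioi hlam hm hpos hanti hx) tendsto_id).const_mul lam
  have h2 : Tendsto (fun y => lam * ∫ t in x..y, f t ∂m) atTop (nhds (0 - D x)) := by
    refine (hlim.sub_const (D x)).congr' ?_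
    filter_upwards [eventually_ge_atTop x] with y hxy
    rw [intervalIntegral.integral_of_le hxy]
    exact hsol.2 x hx y (lt_of_lt_of_le hx hxy) hxy
  linarith [tendsto_nhds_unique h1 h2]
end

section
/- Let (f, D) be a solution of f'' = λ·f·m in integral form on I = (a,∞) with λ > 0, and suppose f is positive and nonincreasing on (a,∞). Set α₊ := lim_{x→∞} f(x). Then for every x ∈ (a,∞), f(x) = α₊ + λ ∫_{(x,∞)} (y − x) f(y) m(dy); in particular the integral on the right-hand side is finite. -/
open MeasureTheory Filter Set

/-- Tonelli: integrating the tails of `g` over `(x, ∞)` gives its first moment about `x`. -/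
theorem lintegral_Ioi_lintegral_Ioi {m : Measure ℝ} {x : ℝ} [SigmaFinite (m.restrict (Ioi x))]
    {g : ℝ → ENNReal} (hg : AEMeasurable g (m.restrict (Ioi x))) :
    ∫⁻ t in Ioi x, ∫⁻ s in Ioi t, g s ∂m = ∫⁻ s in Ioi x, ENNReal.ofReal (s - x) * g s ∂m := by
  have hmeas : AEMeasurable (fun p : ℝ × ℝ => {q : ℝ × ℝ | q.1 < q.2}.indicator (fun q => g q.2) p)
      ((volume.restrict (Ioi x)).prod (m.restrict (Ioi x))) :=
    (hg.comp_snd).indicator (measurableSet_lt measurable_fst measurable_snd)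
  calc ∫⁻ t in Ioi x, ∫⁻ s in Ioi t, g s ∂m
      = ∫⁻ t in Ioi x, ∫⁻ s in Ioi x,
          {q : ℝ × ℝ | q.1 < q.2}.indicator (fun q => g q.2) (t, s) ∂m := by
        refine setLIntegral_congr_fun measurableSet_Ioi fun t ht => ?_
        have h : (fun s => {q : ℝ × ℝ | q.1 < q.2}.indicator (fun q => g q.2) (t, s))
            = (Ioi t).indicator g := by
          ext s
          simp [Set.indicator]
        simp only [h]
        rw [lintegral_indicator measurableSet_Ioi, Measure.restrict_restrict measurableSet_Ioi,
          inter_eq_left.2 (Ioi_subset_Ioi (le_of_lt ht))]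
    _ = ∫⁻ s in Ioi x, ∫⁻ t in Ioi x,
          {q : ℝ × ℝ | q.1 < q.2}.indicator (fun q => g q.2) (t, s) ∂volume ∂m :=
        lintegral_lintegral_swap hmeas
    _ = ∫⁻ s in Ioi x, ENNReal.ofReal (s - x) * g s ∂m := by
        refine setLIntegral_congr_fun measurableSet_Ioi fun s _ => ?_
        have h : (fun t => {q : ℝ × ℝ | q.1 < q.2}.indicator (fun q => g q.2) (t, s))
            = (Iio s).indicator (fun _ => g s) := by
          ext t
          simp [Set.indicator]
        simp only [h]
        rw [lintegral_indicator measurableSet_Iio, Measure.restrict_restrict measurableSet_Iio,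
          setLIntegral_const, Iio_inter_Ioi, Real.volume_Ioo, mul_comm]

/-- The restriction of `m` to a half-line compactly inside `(a, ∞)` is σ-finite. -/
theorem sigmaFinite_restrict_Ioi {m : Measure ℝ} {a x : ℝ} (hx : a < x)
    (hm : ∀ K : Set ℝ, IsCompact K → K ⊆ Ioi a → m K < ⊤) :
    SigmaFinite (m.restrict (Ioi x)) := by
  have : IsFiniteMeasureOnCompacts (m.restrict (Ioi x)) := ⟨fun K hK => by
    rw [Measure.restrict_apply hK.measurableSet]
    exact (measure_mono (inter_subset_inter_right K Ioi_subset_Ici_self)).trans_lt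
      (hm _ (hK.inter_right isClosed_Ici) fun y hy => hx.trans_le hy.2)⟩
  infer_instance

/-- A nonnegative nonincreasing function on `(a, ∞)` converges at infinity. -/
theorem exists_tendsto_of_antitoneOn_Ioi {a : ℝ} {f : ℝ → ℝ} (hanti : AntitoneOn f (Ioi a))
    (hpos : ∀ x ∈ Ioi a, 0 ≤ f x) : ∃ α : ℝ, Tendsto f atTop (nhds α) := by
  have hg : Antitone fun y => f (max y (a + 1)) := fun y z hyz =>
    hanti (by simp) (by simp) (max_le_max_right _ hyz)
  have hb : BddBelow (range fun y => f (max y (a + 1))) :=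
    ⟨0, by rintro _ ⟨y, rfl⟩; exact hpos _ (by simp)⟩
  refine ⟨_, (tendsto_atTop_ciInf hg hb).congr' ?_⟩
  filter_upwards [eventually_ge_atTop (a + 1)] with y hy
  rw [max_eq_left hy]

namespace IsIntegralSolution

variable {m : Measure ℝ} {a lam : ℝ} {f D : ℝ → ℝ}

theorem monotoneOn_deriv_s4 (hsol : IsIntegralSolution m lam (Ioi a) f D) (hlam : 0 ≤ lam)
    (hpos : ∀ x ∈ Ioi a, 0 ≤ f x) : MonotoneOn D (Ioi a) := fun x hx y hy hxy => by
  have h := hsol.2 x hx y hy hxy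
  have h0 : 0 ≤ ∫ t in Ioc x y, f t ∂m :=
    setIntegral_nonneg measurableSet_Ioc fun t ht => hpos t (lt_trans hx ht.1)
  nlinarith [mul_nonneg hlam h0]

theorem intervalIntegrable_deriv (hsol : IsIntegralSolution m lam (Ioi a) f D) (hlam : 0 ≤ lam)
    (hpos : ∀ x ∈ Ioi a, 0 ≤ f x) {x y : ℝ} (hx : a < x) (hxy : x ≤ y) :
    IntervalIntegrable D volume x y :=
  ((hsol.monotoneOn_deriv_s4 hlam hpos).mono (by
    rw [uIcc_of_le hxy]; exact fun t ht => hx.trans_le ht.1)).intervalIntegrable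

theorem deriv_nonpos_s4 (hsol : IsIntegralSolution m lam (Ioi a) f D) (hlam : 0 ≤ lam)
    (hpos : ∀ x ∈ Ioi a, 0 ≤ f x) (hanti : AntitoneOn f (Ioi a)) {x : ℝ} (hx : a < x) :
    D x ≤ 0 := by
  have hx1 : a < x + 1 := by linarith
  have h1 := hsol.1 x hx (x + 1) hx1 (by linarith)
  have h2 : ∫ _ in x..(x + 1), D x ≤ ∫ t in x..(x + 1), D t :=
    intervalIntegral.integral_mono_on (by linarith) (by simp)
      (hsol.intervalIntegrable_deriv hlam hpos hx (by linarith))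
      fun t ht => hsol.monotoneOn_deriv_s4 hlam hpos hx (hx.trans_le ht.1) ht.1
  have h3 := hanti hx hx1 (by linarith)
  simp only [intervalIntegral.integral_const, smul_eq_mul] at h2
  linarith

theorem tendsto_deriv_s4 (hsol : IsIntegralSolution m lam (Ioi a) f D) (hlam : 0 ≤ lam)
    (hpos : ∀ x ∈ Ioi a, 0 ≤ f x) (hanti : AntitoneOn f (Ioi a)) :
    Tendsto D atTop (nhds 0) := by
  obtain ⟨α, hα⟩ := exists_tendsto_of_antitoneOn_Ioi hanti hpos
  have hlow : Tendsto (fun y => f y - f (y - 1)) atTop (nhds 0) := by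
    simpa [← sub_eq_add_neg] using hα.sub (hα.comp (tendsto_atTop_add_const_right atTop (-1 : ℝ) tendsto_id))
  refine tendsto_of_tendsto_of_tendsto_of_le_of_le' hlow tendsto_const_nhds ?_ ?_
  · filter_upwards [eventually_gt_atTop (a + 1)] with y hy
    have hy1 : a < y - 1 := by linarith
    have h1 := hsol.1 (y - 1) hy1 y (by simp only [mem_Ioi]; linarith) (by linarith)
    have h2 : ∫ t in (y - 1)..y, D t ≤ ∫ _ in (y - 1)..y, D y :=
      intervalIntegral.integral_mono_on (by linarith)
        (hsol.intervalIntegrable_deriv hlam hpos hy1 (by linarith)) (by simp)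
        fun t ht => hsol.monotoneOn_deriv_s4 hlam hpos (hy1.trans_le ht.1)
          (by simp only [mem_Ioi]; linarith) ht.2
    simp only [intervalIntegral.integral_const, smul_eq_mul] at h2
    linarith
  · filter_upwards [eventually_gt_atTop a] with y hy
    exact hsol.deriv_nonpos_s4 hlam hpos hanti hy

theorem lintegral_Ioi_deriv (hsol : IsIntegralSolution m lam (Ioi a) f D) (hlam : 0 ≤ lam)
    (hpos : ∀ x ∈ Ioi a, 0 ≤ f x) (hanti : AntitoneOn f (Ioi a)) {α : ℝ}
    (hα : Tendsto f atTop (nhds α)) {x : ℝ} (hx : a < x) :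
    ∫⁻ t in Ioi x, ENNReal.ofReal (-D t) = ENNReal.ofReal (f x - α) := by
  have htend : Tendsto (fun y => ∫ t in x..y, -D t) atTop (nhds (f x - α)) := by
    refine (tendsto_const_nhds.sub hα).congr' ?_
    filter_upwards [eventually_ge_atTop x] with y hy
    rw [intervalIntegral.integral_neg, ← hsol.1 x hx y (hx.trans_le hy) hy]
    ring
  have hloc (y : ℝ) : IntegrableOn (fun t => -D t) (Ioc x y) := by
    rcases le_total x y with h | h
    · exact ((intervalIntegrable_iff_integrableOn_Ioc_of_le h).1
        (hsol.intervalIntegrable_deriv hlam hpos hx h)).neg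
    · simp [Ioc_eq_empty_of_le h]
  have hint : IntegrableOn (fun t => -D t) (Ioi x) := by
    refine integrableOn_Ioi_of_intervalIntegral_norm_tendsto (f x - α) x hloc tendsto_id
      (htend.congr' ?_)
    filter_upwards [eventually_ge_atTop x] with y hy
    refine intervalIntegral.integral_congr fun t ht => ?_
    rw [uIcc_of_le hy] at ht
    have := hsol.deriv_nonpos_s4 hlam hpos hanti (hx.trans_le ht.1)
    simp [abs_of_nonpos this]
  rw [← tendsto_nhds_unique (intervalIntegral_tendsto_integral_Ioi x hint tendsto_id) htend,
    ofReal_integral_eq_lintegral_ofReal hint]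
  filter_upwards [ae_restrict_mem measurableSet_Ioi] with t ht
  have := hsol.deriv_nonpos_s4 hlam hpos hanti (hx.trans ht)
  simpa using this

theorem lintegral_Ioi (hsol : IsIntegralSolution m lam (Ioi a) f D) (hlam : 0 < lam)
    (hm : ∀ K : Set ℝ, IsCompact K → K ⊆ Ioi a → m K < ⊤)
    (hpos : ∀ x ∈ Ioi a, 0 ≤ f x) (hanti : AntitoneOn f (Ioi a)) {x : ℝ} (hx : a < x) :
    ∫⁻ s in Ioi x, ENNReal.ofReal (f s) ∂m = ENNReal.ofReal (lam⁻¹ * -D x) := by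
  have hIoc {y : ℝ} (hy : x ≤ y) : ∫ t in x..y, f t ∂m = lam⁻¹ * (D y - D x) := by
    rw [intervalIntegral.integral_of_le hy, hsol.2 x hx y (hx.trans_le hy) hy,
      inv_mul_cancel_left₀ hlam.ne']
  have htend : Tendsto (fun y => ∫ t in x..y, f t ∂m) atTop (nhds (lam⁻¹ * -D x)) := by
    have h := ((hsol.tendsto_deriv_s4 hlam.le hpos hanti).sub_const (D x)).const_mul lam⁻¹
    rw [zero_sub] at h
    refine h.congr' ?_
    filter_upwards [eventually_ge_atTop x] with y hy
    exact (hIoc hy).symm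
  have hloc (y : ℝ) : IntegrableOn f (Ioc x y) m := by
    have hsub : Icc x y ⊆ Ioi a := fun t ht => hx.trans_le ht.1
    rcases le_total x y with h | h
    · exact ((hanti.mono hsub).integrableOn_of_measure_ne_top (isLeast_Icc h) (isGreatest_Icc h)
        (hm _ isCompact_Icc hsub).ne measurableSet_Icc).mono_set Ioc_subset_Icc_self
    · simp [Ioc_eq_empty_of_le h]
  have hint : IntegrableOn f (Ioi x) m := by
    refine integrableOn_Ioi_of_intervalIntegral_norm_tendsto (lam⁻¹ * -D x) x hloc tendsto_id
      (htend.congr' ?_)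
    filter_upwards [eventually_ge_atTop x] with y hy
    refine intervalIntegral.integral_congr fun t ht => ?_
    rw [uIcc_of_le hy] at ht
    simp [abs_of_nonneg (hpos t (hx.trans_le ht.1))]
  rw [← tendsto_nhds_unique (intervalIntegral_tendsto_integral_Ioi x hint tendsto_id) htend,
    ofReal_integral_eq_lintegral_ofReal hint]
  filter_upwards [ae_restrict_mem measurableSet_Ioi] with t ht
  exact hpos t (hx.trans ht)

end IsIntegralSolution

/-- For a positive nonincreasing solution of `f'' = λ·f·m` on `(a,∞)` with `λ > 0`,
with `α₊ := lim_{x→∞} f(x)`, one has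
`f(x) = α₊ + λ ∫_{(x,∞)} (y − x) f(y) m(dy)`, the integral being finite. -/
theorem integral_solution_decreasing_representation
    (m : MeasureTheory.Measure ℝ) (a lam : ℝ) (hlam : 0 < lam)
    (hm : ∀ K : Set ℝ, IsCompact K → K ⊆ Set.Ioi a → m K < ⊤)
    (f D : ℝ → ℝ)
    (hsol : IsIntegralSolution m lam (Set.Ioi a) f D)
    (hpos : ∀ x ∈ Set.Ioi a, 0 < f x)
    (hanti : AntitoneOn f (Set.Ioi a)) :
    ∃ α : ℝ, Filter.Tendsto f Filter.atTop (nhds α) ∧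
      ∀ x ∈ Set.Ioi a,
        MeasureTheory.IntegrableOn (fun y => (y - x) * f y) (Set.Ioi x) m ∧
        f x = α + lam * ∫ y in Set.Ioi x, (y - x) * f y ∂m := by
  have hpos' : ∀ x ∈ Ioi a, 0 ≤ f x := fun x hx => (hpos x hx).le
  obtain ⟨α, hα⟩ := exists_tendsto_of_antitoneOn_Ioi hanti hpos'
  refine ⟨α, hα, fun x hx => ?_⟩
  have := sigmaFinite_restrict_Ioi hx hm
  have hxy {y : ℝ} (hy : y ∈ Ioi x) : y ∈ Ioi a := Ioi_subset_Ioi (le_of_lt hx) hy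
  have hf : AEMeasurable f (m.restrict (Ioi x)) :=
    aemeasurable_restrict_of_antitoneOn measurableSet_Ioi
      (hanti.mono (Ioi_subset_Ioi (le_of_lt hx)))
  have hle : α ≤ f x := le_of_tendsto hα <| by
    filter_upwards [eventually_ge_atTop x] with y hy
    exact hanti hx (lt_of_lt_of_le hx hy) hy
  have hmoment : ∫⁻ y in Ioi x, ENNReal.ofReal ((y - x) * f y) ∂m
      = ENNReal.ofReal (lam⁻¹ * (f x - α)) :=
    calc ∫⁻ y in Ioi x, ENNReal.ofReal ((y - x) * f y) ∂m
        = ∫⁻ y in Ioi x, ENNReal.ofReal (y - x) * ENNReal.ofReal (f y) ∂m :=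
          setLIntegral_congr_fun measurableSet_Ioi fun y hy =>
            ENNReal.ofReal_mul (sub_nonneg.2 (le_of_lt hy))
      _ = ∫⁻ t in Ioi x, ∫⁻ s in Ioi t, ENNReal.ofReal (f s) ∂m :=
          (lintegral_Ioi_lintegral_Ioi hf.ennreal_ofReal).symm
      _ = ∫⁻ t in Ioi x, ENNReal.ofReal lam⁻¹ * ENNReal.ofReal (-D t) :=
          setLIntegral_congr_fun measurableSet_Ioi fun t ht => by
            rw [← ENNReal.ofReal_mul (inv_nonneg.2 hlam.le)]
            exact hsol.lintegral_Ioi hlam hm hpos' hanti (hxy ht)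
      _ = ENNReal.ofReal (lam⁻¹ * (f x - α)) := by
          rw [lintegral_const_mul' _ _ ENNReal.ofReal_ne_top,
            hsol.lintegral_Ioi_deriv hlam.le hpos' hanti hα hx,
            ENNReal.ofReal_mul (inv_nonneg.2 hlam.le)]
  have hmeas : AEStronglyMeasurable (fun y => (y - x) * f y) (m.restrict (Ioi x)) :=
    ((measurable_id.sub_const x).aemeasurable.mul hf).aestronglyMeasurable
  have hnonneg : 0 ≤ᵐ[m.restrict (Ioi x)] fun y => (y - x) * f y := by
    filter_upwards [ae_restrict_mem measurableSet_Ioi] with y hy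
    exact mul_nonneg (sub_nonneg.2 (le_of_lt hy)) (hpos' y (hxy hy))
  refine ⟨⟨hmeas, ?_⟩, ?_⟩
  · rw [hasFiniteIntegral_iff_ofReal hnonneg, hmoment]
    exact ENNReal.ofReal_lt_top
  · rw [integral_eq_lintegral_of_nonneg_ae hnonneg hmeas, hmoment,
      ENNReal.toReal_ofReal (mul_nonneg (inv_nonneg.2 hlam.le) (sub_nonneg.2 hle)),
      mul_inv_cancel_left₀ hlam.ne']
    ring
end

section
/- Let (f, D) be a solution of f'' = λ·f·m in integral form on I = (a,∞) with λ > 0, and suppose f is positive and nonincreasing on (a,∞). Set α₊ := lim_{x→∞} f(x). Then for every x ∈ (a,∞), the function y ↦ y f(y) is m-integrable on (x,∞) and λ ∫_{(x,∞)} y f(y) m(dy) = f(x) − α₊ − x·D(x). -/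
open MeasureTheory Filter Set

/-- A nonnegative function whose integrals over `(x, y]` converge as `y → ∞` is integrable on
`(x, ∞)`, with integral the limit. -/
theorem integrableOn_Ioi_and_integral_eq_of_tendsto {m : Measure ℝ} {g : ℝ → ℝ} {x l : ℝ}
    (hint : ∀ y, IntegrableOn g (Ioc x y) m) (hg : ∀ y ∈ Ioi x, 0 ≤ g y)
    (hlim : Tendsto (fun y => ∫ t in Ioc x y, g t ∂m) atTop (nhds l)) :
    IntegrableOn g (Ioi x) m ∧ ∫ t in Ioi x, g t ∂m = l := by
  have hlim' : Tendsto (fun y => ∫ t in x..y, g t ∂m) atTop (nhds l) := by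
    refine hlim.congr' ?_
    filter_upwards [eventually_ge_atTop x] with y hy
    rw [intervalIntegral.integral_of_le hy]
  have hi : IntegrableOn g (Ioi x) m := by
    refine integrableOn_Ioi_of_intervalIntegral_norm_tendsto l x hint tendsto_id ?_
    refine hlim.congr' ?_
    filter_upwards [eventually_ge_atTop x] with y hy
    rw [intervalIntegral.integral_of_le hy]
    refine setIntegral_congr_fun measurableSet_Ioc fun t ht => ?_
    exact (Real.norm_of_nonneg (hg t ht.1)).symm
  exact ⟨hi, tendsto_nhds_unique
    (intervalIntegral_tendsto_integral_Ioi x hi tendsto_id) hlim'⟩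

/-- Fubini for the first moment about the left endpoint. -/
theorem setIntegral_Ioc_sub_mul_eq {m : Measure ℝ} {f : ℝ → ℝ} {x y : ℝ}
    (hm : m (Ioc x y) < ⊤) (hf : IntegrableOn f (Ioc x y) m) :
    ∫ t in Ioc x y, (t - x) * f t ∂m = ∫ s in Ioc x y, ∫ t in Ioc s y, f t ∂m := by
  have : IsFiniteMeasure (m.restrict (Ioc x y)) := ⟨by simpa using hm⟩
  have hs : MeasurableSet {p : ℝ × ℝ | p.1 < p.2} := measurableSet_lt measurable_fst measurable_snd
  have hi : Integrable
      (Function.uncurry fun s t => (Ioi s).indicator f t)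
      ((volume.restrict (Ioc x y)).prod (m.restrict (Ioc x y))) := by
    refine ((Integrable.comp_snd hf (volume.restrict (Ioc x y))).indicator hs).congr
      (ae_of_all _ fun p => ?_)
    simp [indicator, Function.uncurry]
  have hswap := integral_integral_swap hi
  calc
    ∫ t in Ioc x y, (t - x) * f t ∂m
        = ∫ t in Ioc x y, (∫ s in Ioc x y, (Ioi s).indicator f t) ∂m := by
      refine setIntegral_congr_fun measurableSet_Ioc fun t ht => ?_
      have h1 : (fun s => (Ioi s).indicator f t) = (Iio t).indicator fun _ => f t := by
        ext s; simp [indicator]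
      have h2 : Ioc x y ∩ Iio t = Ioo x t := by
        ext s; simp only [mem_inter_iff, mem_Ioc, mem_Iio, mem_Ioo]
        exact ⟨fun h => ⟨h.1.1, h.2⟩, fun h => ⟨⟨h.1, h.2.le.trans ht.2⟩, h.2⟩⟩
      simp only [h1]
      rw [setIntegral_indicator measurableSet_Iio, h2, setIntegral_const,
        Real.volume_real_Ioo_of_le ht.1.le, smul_eq_mul]
    _ = ∫ s in Ioc x y, (∫ t in Ioc x y, (Ioi s).indicator f t ∂m) := hswap.symm
    _ = ∫ s in Ioc x y, ∫ t in Ioc s y, f t ∂m := by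
      refine setIntegral_congr_fun measurableSet_Ioc fun s hs => ?_
      have h2 : Ioc x y ∩ Ioi s = Ioc s y := by
        ext t; simp only [mem_inter_iff, mem_Ioc, mem_Ioi]
        exact ⟨fun h => ⟨h.2, h.1.2⟩, fun h => ⟨⟨hs.1.trans h.1, h.2⟩, h.1⟩⟩
      rw [setIntegral_indicator measurableSet_Ioi, h2]

/-- For a positive nonincreasing solution of `f'' = λ·f·m` on `(a,∞)` with `λ > 0`,
with `α₊ := lim_{x→∞} f(x)`, the function `y ↦ y f(y)` is `m`-integrable on `(x,∞)`
and `λ ∫_{(x,∞)} y f(y) m(dy) = f(x) − α₊ − x·D(x)`. -/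
theorem integral_solution_decreasing_moment_formula
    (m : MeasureTheory.Measure ℝ) (a lam : ℝ) (hlam : 0 < lam)
    (hm : ∀ K : Set ℝ, IsCompact K → K ⊆ Set.Ioi a → m K < ⊤)
    (f D : ℝ → ℝ)
    (hsol : IsIntegralSolution m lam (Set.Ioi a) f D)
    (hpos : ∀ x ∈ Set.Ioi a, 0 < f x)
    (hanti : AntitoneOn f (Set.Ioi a)) :
    ∃ α : ℝ, Filter.Tendsto f Filter.atTop (nhds α) ∧
      ∀ x ∈ Set.Ioi a,
        MeasureTheory.IntegrableOn (fun y => y * f y) (Set.Ioi x) m ∧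
        lam * ∫ y in Set.Ioi x, y * f y ∂m = f x - α - x * D x := by
  obtain ⟨hf, hD⟩ := hsol
  have hmIoc : ∀ x ∈ Ioi a, ∀ y, m (Ioc x y) < ⊤ := fun x hx y =>
    (measure_mono Ioc_subset_Icc_self).trans_lt
      (hm (Icc x y) isCompact_Icc fun t ht => lt_of_lt_of_le hx ht.1)
  have hfint : ∀ x ∈ Ioi a, ∀ y, IntegrableOn f (Ioc x y) m := by
    intro x hx y
    have hsub : Icc x y ⊆ Ioi a := fun t ht => lt_of_lt_of_le hx ht.1
    rcases le_or_gt x y with hxy | hxy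
    · exact ((hanti.mono hsub).integrableOn_of_measure_ne_top (isLeast_Icc hxy)
        (isGreatest_Icc hxy) (hm _ isCompact_Icc hsub).ne measurableSet_Icc).mono_set
        Ioc_subset_Icc_self
    · simp [Ioc_eq_empty_of_le hxy.le]
  have hDmono : MonotoneOn D (Ioi a) := by
    intro x hx y hy hxy
    have h := hD x hx y hy hxy
    have h0 : 0 ≤ ∫ t in Ioc x y, f t ∂m :=
      setIntegral_nonneg measurableSet_Ioc fun t ht => (hpos t (lt_trans hx ht.1)).le
    nlinarith [mul_nonneg hlam.le h0]
  have hDint : ∀ x ∈ Ioi a, ∀ y ∈ Ioi a, IntervalIntegrable D volume x y := by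
    intro x hx y hy
    exact (hDmono.mono fun t ht => lt_of_lt_of_le (lt_min hx hy) ht.1).intervalIntegrable
  have hlow : ∀ x ∈ Ioi a, ∀ y ∈ Ioi a, x ≤ y → (y - x) * D x ≤ f y - f x := by
    intro x hx y hy hxy
    rw [hf x hx y hy hxy]
    calc (y - x) * D x = ∫ _ in x..y, D x := by simp
      _ ≤ _ := intervalIntegral.integral_mono_on hxy (by simp) (hDint x hx y hy) fun t ht =>
        hDmono hx (lt_of_lt_of_le hx ht.1) ht.1
  have hupp : ∀ x ∈ Ioi a, ∀ y ∈ Ioi a, x ≤ y → f y - f x ≤ (y - x) * D y := by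
    intro x hx y hy hxy
    rw [hf x hx y hy hxy]
    calc _ ≤ ∫ _ in x..y, D y :=
          intervalIntegral.integral_mono_on hxy (hDint x hx y hy) (by simp) fun t ht =>
            hDmono (lt_of_lt_of_le hx ht.1) hy ht.2
      _ = (y - x) * D y := by simp
  have hDnonpos : ∀ x ∈ Ioi a, D x ≤ 0 := by
    intro x hx
    have hx1 : x + 1 ∈ Ioi a := lt_trans hx (lt_add_one x)
    have h1 := hlow x hx (x + 1) hx1 (by linarith)
    have h2 := hanti hx hx1 (by linarith)
    linarith
  obtain ⟨α, hα⟩ : ∃ α, Tendsto f atTop (nhds α) := by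
    have hanti' : Antitone fun y => f (max y (a + 1)) := fun y z hyz =>
      hanti (lt_of_lt_of_le (lt_add_one a) (le_max_right _ _))
        (lt_of_lt_of_le (lt_add_one a) (le_max_right _ _)) (max_le_max_right _ hyz)
    refine ⟨_, (tendsto_atTop_ciInf hanti' ⟨0, ?_⟩).congr' ?_⟩
    · rintro _ ⟨y, rfl⟩
      exact (hpos _ (lt_of_lt_of_le (lt_add_one a) (le_max_right _ _))).le
    · filter_upwards [eventually_ge_atTop (a + 1)] with y hy
      simp [max_eq_left hy]
  refine ⟨α, hα, fun x hx => ?_⟩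
  have hDx : Tendsto (fun y => (y - x) * D y) atTop (nhds 0) := by
    have hmid : Tendsto (fun y : ℝ => (x + y) / 2) atTop atTop :=
      (tendsto_atTop_add_const_left _ x tendsto_id).atTop_div_const two_pos
    have hlim : Tendsto (fun y => 2 * (f y - f ((x + y) / 2))) atTop (nhds 0) := by
      simpa using (hα.sub (hα.comp hmid)).const_mul 2
    refine tendsto_of_tendsto_of_tendsto_of_le_of_le' hlim tendsto_const_nhds ?_ ?_
    · filter_upwards [eventually_ge_atTop x] with y hy
      have hmem : (x + y) / 2 ∈ Ioi a := lt_of_lt_of_le hx (show x ≤ (x + y) / 2 by linarith)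
      have := hupp _ hmem y (lt_of_lt_of_le hx hy) (by linarith)
      linarith
    · filter_upwards [eventually_ge_atTop x] with y hy
      exact mul_nonpos_of_nonneg_of_nonpos (by linarith) (hDnonpos y (lt_of_lt_of_le hx hy))
  have hD0 : Tendsto D atTop (nhds 0) := by
    refine tendsto_of_tendsto_of_tendsto_of_le_of_le' hDx tendsto_const_nhds ?_ ?_
    · filter_upwards [eventually_ge_atTop (x + 1)] with y hy
      nlinarith [hDnonpos y (lt_of_lt_of_le hx (show x ≤ y by linarith))]
    · filter_upwards [eventually_ge_atTop x] with y hy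
      exact hDnonpos y (lt_of_lt_of_le hx hy)
  obtain ⟨hfI, hfE⟩ := integrableOn_Ioi_and_integral_eq_of_tendsto (g := f) (x := x)
    (l := (0 - D x) / lam)
    (hfint x hx) (fun t ht => (hpos t (lt_trans (mem_Ioi.1 hx) ht)).le) (by
      refine ((hD0.sub_const (D x)).div_const lam).congr' ?_
      filter_upwards [eventually_ge_atTop x] with y hy
      rw [hD x hx y (lt_of_lt_of_le hx hy) hy, mul_div_cancel_left₀ _ hlam.ne'])
  have hmoment : ∀ y, x ≤ y →
      ∫ t in Ioc x y, (t - x) * f t ∂m = ((y - x) * D y - (f y - f x)) / lam := by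
    intro y hy
    have hya : y ∈ Ioi a := lt_of_lt_of_le hx hy
    have hinner : ∀ s ∈ Ioc x y, ∫ t in Ioc s y, f t ∂m = (D y - D s) / lam := fun s hs => by
      rw [hD s (lt_trans hx hs.1) y hya hs.2, mul_div_cancel_left₀ _ hlam.ne']
    rw [setIntegral_Ioc_sub_mul_eq (hmIoc x hx y) (hfint x hx y),
      setIntegral_congr_fun measurableSet_Ioc hinner, ← intervalIntegral.integral_of_le hy,
      intervalIntegral.integral_div, intervalIntegral.integral_sub (by simp) (hDint x hx y hya),
      hf x hx y hya hy]
    simp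
  obtain ⟨hgI, hgE⟩ := integrableOn_Ioi_and_integral_eq_of_tendsto (m := m)
    (g := fun t => (t - x) * f t) (x := x) (l := (0 - (α - f x)) / lam)
    (fun y => by
      refine (hfint x hx y).bdd_mul (c := y - x) (by fun_prop) ?_
      filter_upwards [ae_restrict_mem measurableSet_Ioc] with t ht
      rw [Real.norm_of_nonneg (by linarith [ht.1])]
      linarith [ht.2])
    (fun t ht => mul_nonneg (sub_nonneg.2 (le_of_lt ht)) (hpos t (lt_trans (mem_Ioi.1 hx) ht)).le) (by
      refine ((hDx.sub (hα.sub_const (f x))).div_const lam).congr' ?_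
      filter_upwards [eventually_ge_atTop x] with y hy
      exact (hmoment y hy).symm)
  have hsplit : (fun y => y * f y) = fun y => (y - x) * f y + x * f y := by
    ext y; ring
  rw [hsplit]
  refine ⟨hgI.add (hfI.const_mul x), ?_⟩
  rw [integral_add hgI (hfI.const_mul x), integral_const_mul, hgE, hfE]
  field_simp
  ring
end

section
/- Let l ∈ ℝ and let (f, D) be a solution of f'' = λ·f·m in integral form on I = (l, b) with λ > 0, where f is positive and nondecreasing with lim_{x↓l} f(x) = 0, the limit d := lim_{x↓l} D(x) exists in ℝ, and ∫_{(l,x]} f dm < ∞ for all x ∈ (l,b). Then for every x ∈ (l,b): D(x) = d + λ ∫_{(l,x]} f(y) m(dy); f(x) = d(x − l) + λ ∫_{(l,x]} (x − y) f(y) m(dy); and λ ∫_{(l,x]} y f(y) m(dy) = d(x − l) − f(x) + λ x ∫_{(l,x]} f(y) m(dy). -/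
open MeasureTheory Filter Set

open scoped Topology

/-- Set integrals over `(s, x]` converge to the one over `(l, x]` as `s ↓ l`. -/
theorem tendsto_setIntegral_Ioc_left {μ : Measure ℝ} {g : ℝ → ℝ} {l x : ℝ}
    (hg : IntegrableOn g (Ioc l x) μ) :
    Tendsto (fun s => ∫ t in Ioc s x, g t ∂μ) (𝓝[>] l) (𝓝 (∫ t in Ioc l x, g t ∂μ)) := by
  have hcover : AECover (μ.restrict (Ioc l x)) (𝓝[>] l) fun s => Ioi s :=
    (aecover_Ioi_of_Ioi (tendsto_id.mono_left nhdsWithin_le_nhds)).mono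
      (Measure.restrict_mono Ioc_subset_Ioi_self le_rfl)
  refine (hcover.integral_tendsto_of_countably_generated hg).congr' ?_
  filter_upwards [self_mem_nhdsWithin] with s hs
  rw [Measure.restrict_restrict measurableSet_Ioi, inter_comm, Ioc_inter_Ioi, max_eq_right (le_of_lt hs)]

/-- A measure that is finite on `[s, x]` for all `s > l` is σ-finite on `(l, x]`. -/
theorem sigmaFinite_restrict_Ioc {μ : Measure ℝ} {l x : ℝ}
    (h : ∀ s, l < s → μ (Icc s x) < ⊤) : SigmaFinite (μ.restrict (Ioc l x)) := by
  refine ⟨⟨⟨fun n : ℕ => Ici (l + 1 / ((n : ℝ) + 1)) ∪ Iic l, fun _ => trivial, fun n => ?_, ?_⟩⟩⟩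
  · have hn : l < l + 1 / ((n : ℝ) + 1) := lt_add_of_pos_right _ Nat.one_div_pos_of_nat
    rw [Measure.restrict_apply (measurableSet_Ici.union measurableSet_Iic)]
    refine (measure_mono ?_).trans_lt (h _ hn)
    rintro y ⟨hy | hy, hy'⟩
    · exact ⟨hy, hy'.2⟩
    · exact absurd hy'.1 (not_lt.2 hy)
  · refine eq_univ_of_forall fun y => mem_iUnion.2 ?_
    rcases le_or_gt y l with hy | hy
    · exact ⟨0, Or.inr hy⟩
    · obtain ⟨n, hn⟩ := exists_nat_one_div_lt (sub_pos.2 hy)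
      exact ⟨n, Or.inl (by rw [mem_Ici]; linarith)⟩

/-- Cauchy's formula for repeated integration of a density against a measure. -/
theorem setIntegral_Ioc_setIntegral_Ioc {μ : Measure ℝ} {g : ℝ → ℝ} {l x : ℝ}
    [SFinite (μ.restrict (Ioc l x))] (hg : IntegrableOn g (Ioc l x) μ) :
    ∫ t in Ioc l x, ∫ y in Ioc l t, g y ∂μ = ∫ y in Ioc l x, (x - y) * g y ∂μ := by
  have hint : Integrable (Function.uncurry fun t y : ℝ => (Iic t).indicator g y)
      ((volume.restrict (Ioc l x)).prod (μ.restrict (Ioc l x))) :=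
    (hg.comp_snd (volume.restrict (Ioc l x))).indicator
      (measurableSet_le measurable_snd measurable_fst)
  calc ∫ t in Ioc l x, ∫ y in Ioc l t, g y ∂μ
      = ∫ t in Ioc l x, ∫ y in Ioc l x, (Iic t).indicator g y ∂μ := by
        refine setIntegral_congr_fun measurableSet_Ioc fun t ht => ?_
        rw [integral_indicator measurableSet_Iic, Measure.restrict_restrict measurableSet_Iic,
          inter_comm, Ioc_inter_Iic, min_eq_right ht.2]
    _ = ∫ y in Ioc l x, (∫ t in Ioc l x, (Iic t).indicator g y) ∂μ :=
        integral_integral_swap hint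
    _ = ∫ y in Ioc l x, (x - y) * g y ∂μ := by
        refine setIntegral_congr_fun measurableSet_Ioc fun y hy => ?_
        have hswap : (fun t : ℝ => (Iic t).indicator g y) = (Ici y).indicator fun _ => g y := by
          ext t
          simp [indicator_apply]
        have hset : Ici y ∩ Ioc l x = Icc y x := by
          ext t
          simp only [mem_inter_iff, mem_Ici, mem_Ioc, mem_Icc]
          exact ⟨fun h => ⟨h.1, h.2.2⟩, fun h => ⟨h.1, hy.1.trans_le h.1, h.2⟩⟩
        rw [hswap, integral_indicator measurableSet_Ici, Measure.restrict_restrict measurableSet_Ici,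
          hset, setIntegral_const, Real.volume_real_Icc_of_le hy.2, smul_eq_mul]

/-- Identities for the positive increasing solution `f₋` on `(l, b)` with
`f₋(l+) = 0` and `D(l+) = d`:
`D(x) = d + λ ∫_{(l,x]} f dm`,
`f(x) = d (x − l) + λ ∫_{(l,x]} (x − y) f(y) m(dy)`, and
`λ ∫_{(l,x]} y f(y) m(dy) = d (x − l) − f(x) + λ x ∫_{(l,x]} f dm`. -/
theorem integral_solution_increasing_representation
    (m : MeasureTheory.Measure ℝ) (l b lam : ℝ) (hlb : l < b) (hlam : 0 < lam)
    (hm : ∀ K : Set ℝ, IsCompact K → K ⊆ Set.Ioo l b → m K < ⊤)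
    (f D : ℝ → ℝ)
    (hsol : IsIntegralSolution m lam (Set.Ioo l b) f D)
    (hpos : ∀ x ∈ Set.Ioo l b, 0 < f x)
    (hmono : MonotoneOn f (Set.Ioo l b))
    (hf0 : Filter.Tendsto f (nhdsWithin l (Set.Ioi l)) (nhds 0))
    (d : ℝ)
    (hD0 : Filter.Tendsto D (nhdsWithin l (Set.Ioi l)) (nhds d))
    (hint : ∀ x ∈ Set.Ioo l b, MeasureTheory.IntegrableOn f (Set.Ioc l x) m) :
    ∀ x ∈ Set.Ioo l b,
      D x = d + lam * ∫ y in Set.Ioc l x, f y ∂m ∧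
      f x = d * (x - l) + lam * ∫ y in Set.Ioc l x, (x - y) * f y ∂m ∧
      lam * ∫ y in Set.Ioc l x, y * f y ∂m
        = d * (x - l) - f x + lam * x * ∫ y in Set.Ioc l x, f y ∂m := by
  have hD : ∀ x ∈ Ioo l b, D x = d + lam * ∫ y in Ioc l x, f y ∂m := by
    intro x hx
    have hlim := hD0.add ((tendsto_setIntegral_Ioc_left (hint x hx)).const_mul lam)
    refine tendsto_nhds_unique (tendsto_const_nhds.congr' ?_) hlim
    filter_upwards [Ioo_mem_nhdsGT hx.1] with s hs
    have := hsol.2 s ⟨hs.1, hs.2.trans hx.2⟩ x hx hs.2.le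
    linarith
  intro x hx
  have hFmono : MonotoneOn (fun t => ∫ y in Ioc l t, f y ∂m) (Ioc l x) := by
    intro s _ t ht hst
    have htb : t < b := ht.2.trans_lt hx.2
    refine setIntegral_mono_set (hint t ⟨ht.1, htb⟩) ?_ (Ioc_subset_Ioc_right hst).eventuallyLE
    exact ae_restrict_of_forall_mem measurableSet_Ioc fun y hy =>
      (hpos y ⟨hy.1, hy.2.trans_lt htb⟩).le
  have hFbound : ∀ t ∈ Ioc l x, ‖∫ y in Ioc l t, f y ∂m‖ ≤ ∫ y in Ioc l x, f y ∂m := by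
    intro t ht
    rw [Real.norm_of_nonneg]
    · exact hFmono ht ⟨hx.1, le_rfl⟩ ht.2
    · exact setIntegral_nonneg measurableSet_Ioc fun y hy =>
        (hpos y ⟨hy.1, (hy.2.trans ht.2).trans_lt hx.2⟩).le
  have hFint : IntegrableOn (fun t => ∫ y in Ioc l t, f y ∂m) (Ioc l x) :=
    Integrable.of_bound
      (aemeasurable_restrict_of_monotoneOn measurableSet_Ioc hFmono).aestronglyMeasurable _
      (ae_restrict_of_forall_mem measurableSet_Ioc hFbound)
  have hDeq : EqOn (fun t => d + lam * ∫ y in Ioc l t, f y ∂m) D (Ioc l x) := fun t ht =>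
    (hD t ⟨ht.1, ht.2.trans_lt hx.2⟩).symm
  have hconst : IntegrableOn (fun _ : ℝ => d) (Ioc l x) := integrableOn_const measure_Ioc_lt_top.ne
  have hDint : IntegrableOn D (Ioc l x) :=
    (hconst.add (hFint.const_mul lam)).congr_fun hDeq measurableSet_Ioc
  have hfD : f x = ∫ t in Ioc l x, D t := by
    have hlim := hf0.add (tendsto_setIntegral_Ioc_left hDint)
    rw [zero_add] at hlim
    refine tendsto_nhds_unique (tendsto_const_nhds.congr' ?_) hlim
    filter_upwards [Ioo_mem_nhdsGT hx.1] with s hs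
    have := hsol.1 s ⟨hs.1, hs.2.trans hx.2⟩ x hx hs.2.le
    rw [intervalIntegral.integral_of_le hs.2.le] at this
    linarith
  have : SigmaFinite (m.restrict (Ioc l x)) := sigmaFinite_restrict_Ioc fun s hs =>
    hm _ isCompact_Icc fun y hy => ⟨hs.trans_le hy.1, hy.2.trans_lt hx.2⟩
  have hf : f x = d * (x - l) + lam * ∫ y in Ioc l x, (x - y) * f y ∂m := by
    rw [← setIntegral_Ioc_setIntegral_Ioc (hint x hx), hfD,
      ← setIntegral_congr_fun measurableSet_Ioc hDeq,
      integral_add hconst (hFint.const_mul lam), integral_const_mul, setIntegral_const,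
      Real.volume_real_Ioc_of_le hx.1.le, smul_eq_mul, mul_comm d]
  have hyf : IntegrableOn (fun y => y * f y) (Ioc l x) m :=
    (hint x hx).bdd_mul (c := max |l| |x|) aestronglyMeasurable_id
      (ae_restrict_of_forall_mem measurableSet_Ioc fun y hy =>
        abs_le_max_abs_abs hy.1.le hy.2)
  have hsplit : ∫ y in Ioc l x, (x - y) * f y ∂m
      = x * (∫ y in Ioc l x, f y ∂m) - ∫ y in Ioc l x, y * f y ∂m := by
    rw [← integral_const_mul, ← integral_sub ((hint x hx).const_mul x) hyf]
    simp only [sub_mul]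
  refine ⟨hD x hx, hf, ?_⟩
  rw [hsplit] at hf
  linear_combination hf
end

section
/- Let m be a nonnegative Borel measure on [0,∞) that is finite on compact sets. Define φ₀ ≡ 1 and φₙ(x) = ∫_{(0,x]} (x − y) φ_{n−1}(y) m(dy) for n ≥ 1. Then for every λ ∈ ℝ the series φ(x) := Σ_{n=0}^∞ λⁿ φₙ(x) converges absolutely for every x ≥ 0, uniformly on compact subsets of [0,∞) × ℝ in (x, λ), and its sum satisfies φ(x) = 1 + λ ∫_{(0,x]} (x − y) φ(y) m(dy) for all x ≥ 0. -/
open MeasureTheory Filter Set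

/-- The tangent-line inequality for the convex function `t ↦ t ^ (n + 1)` on `[0, ∞)`. -/
lemma succ_mul_pow_mul_sub_le {x y : ℝ} (hy : 0 ≤ y) (hyx : y ≤ x) (n : ℕ) :
    (n + 1) * y ^ n * (x - y) ≤ x ^ (n + 1) - y ^ (n + 1) := by
  induction n with
  | zero => simp
  | succ n ih =>
    have h₁ := mul_le_mul_of_nonneg_left ih (hy.trans hyx)
    have h₂ : 0 ≤ (n + 1) * y ^ n * (x - y) ^ 2 := by positivity
    push_cast
    ring_nf at h₁ h₂ ⊢
    linarith

section SuccessiveApproximation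

variable {m : Measure ℝ} [IsFiniteMeasureOnCompacts m] {φ : ℕ → ℝ → ℝ}

/-- Each iterate is bounded by the `n`-th term of an exponential series. -/
lemma abs_successive_approximation_le (hφ0 : ∀ x : ℝ, φ 0 x = 1)
    (hφ : ∀ n : ℕ, ∀ x : ℝ, φ (n + 1) x = ∫ y in Ioc (0 : ℝ) x, (x - y) * φ n y ∂m)
    {X : ℝ} (n : ℕ) {x : ℝ} (hx : 0 ≤ x) (hxX : x ≤ X) :
    |φ n x| ≤ (m.real (Ioc 0 X) * x) ^ n / n.factorial := by
  induction n generalizing x with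
  | zero => simp [hφ0]
  | succ n ih =>
    set M := m.real (Ioc 0 X)
    have hM : 0 ≤ M := measureReal_nonneg
    have hbound : ∀ y ∈ Ioc 0 x,
        ‖(x - y) * φ n y‖ ≤ M ^ n * x ^ (n + 1) / (n + 1).factorial := by
      rintro y ⟨hy, hyx⟩
      have htan := succ_mul_pow_mul_sub_le hy.le hyx n
      have hpow : 0 ≤ y ^ (n + 1) := by positivity
      rw [Real.norm_eq_abs, abs_mul, abs_of_nonneg (sub_nonneg.2 hyx)]
      calc (x - y) * |φ n y| ≤ (x - y) * ((M * y) ^ n / n.factorial) :=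
            mul_le_mul_of_nonneg_left (ih hy.le (hyx.trans hxX)) (sub_nonneg.2 hyx)
        _ = M ^ n * ((n + 1) * y ^ n * (x - y)) / (n + 1).factorial := by
            rw [Nat.factorial_succ]
            push_cast
            field_simp
            ring
        _ ≤ M ^ n * x ^ (n + 1) / (n + 1).factorial := by
            gcongr
            linarith
    have hmono : m.real (Ioc 0 x) ≤ M :=
      measureReal_mono (Ioc_subset_Ioc_right hxX) measure_Ioc_lt_top.ne
    rw [hφ, ← Real.norm_eq_abs]
    calc _ ≤ M ^ n * x ^ (n + 1) / (n + 1).factorial * m.real (Ioc 0 x) :=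
          norm_setIntegral_le_of_norm_le_const measure_Ioc_lt_top hbound
      _ ≤ M ^ n * x ^ (n + 1) / (n + 1).factorial * M := by gcongr
      _ = (M * x) ^ (n + 1) / (n + 1).factorial := by ring

lemma norm_pow_mul_successive_approximation_le (hφ0 : ∀ x : ℝ, φ 0 x = 1)
    (hφ : ∀ n : ℕ, ∀ x : ℝ, φ (n + 1) x = ∫ y in Ioc (0 : ℝ) x, (x - y) * φ n y ∂m)
    {X L lam : ℝ} (n : ℕ) {x : ℝ} (hx : 0 ≤ x) (hxX : x ≤ X) (hlam : |lam| ≤ L) :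
    ‖lam ^ n * φ n x‖ ≤ (L * (m.real (Ioc 0 X) * X)) ^ n / n.factorial := by
  have hM : 0 ≤ m.real (Ioc 0 X) := measureReal_nonneg
  rw [norm_mul, norm_pow, Real.norm_eq_abs, Real.norm_eq_abs, mul_pow, mul_div_assoc]
  refine mul_le_mul (by gcongr) ?_ (abs_nonneg _) (pow_nonneg ((abs_nonneg _).trans hlam) _)
  refine (abs_successive_approximation_le hφ0 hφ n hx hxX).trans ?_
  gcongr

lemma stronglyMeasurable_successive_approximation (hφ0 : ∀ x : ℝ, φ 0 x = 1)
    (hφ : ∀ n : ℕ, ∀ x : ℝ, φ (n + 1) x = ∫ y in Ioc (0 : ℝ) x, (x - y) * φ n y ∂m)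
    (n : ℕ) : StronglyMeasurable (φ n) := by
  induction n with
  | zero =>
    rw [show φ 0 = fun _ => 1 from funext hφ0]
    exact stronglyMeasurable_const
  | succ n ih =>
    have hset : MeasurableSet {p : ℝ × ℝ | 0 < p.2 ∧ p.2 ≤ p.1} :=
      (measurableSet_lt measurable_const measurable_snd).inter
        (measurableSet_le measurable_snd measurable_fst)
    have hint : StronglyMeasurable
        ({p : ℝ × ℝ | 0 < p.2 ∧ p.2 ≤ p.1}.indicator fun p => (p.1 - p.2) * φ n p.2) :=
      ((measurable_fst.sub measurable_snd).stronglyMeasurable.mul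
        (ih.comp_measurable measurable_snd)).indicator hset
    convert hint.integral_prod_right' (ν := m) using 1
    funext x
    rw [hφ, ← integral_indicator measurableSet_Ioc]
    rfl

end SuccessiveApproximation


/-- Successive approximation for `φ`: with `φ₀ ≡ 1` and
`φₙ(x) = ∫_{(0,x]} (x − y) φ_{n−1}(y) m(dy)`, the series `Σ λⁿ φₙ(x)` converges
absolutely for each `x ≥ 0`, uniformly on compact subsets of `[0,∞) × ℝ` in `(x, λ)`,
and its sum `φ` satisfies `φ(x) = 1 + λ ∫_{(0,x]} (x − y) φ(y) m(dy)`. -/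
theorem successive_approximation_phi
    (m : MeasureTheory.Measure ℝ)
    (hm : ∀ K : Set ℝ, IsCompact K → m K < ⊤)
    (φ : ℕ → ℝ → ℝ)
    (hφ0 : ∀ x : ℝ, φ 0 x = 1)
    (hφ : ∀ n : ℕ, ∀ x : ℝ,
      φ (n + 1) x = ∫ y in Set.Ioc (0 : ℝ) x, (x - y) * φ n y ∂m) :
    (∀ lam : ℝ, ∀ x : ℝ, 0 ≤ x → Summable (fun n : ℕ => |lam ^ n * φ n x|)) ∧
    (∀ K : Set (ℝ × ℝ), IsCompact K → K ⊆ Set.Ici (0 : ℝ) ×ˢ (Set.univ : Set ℝ) →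
      TendstoUniformlyOn
        (fun (N : ℕ) (p : ℝ × ℝ) => ∑ n ∈ Finset.range N, p.2 ^ n * φ n p.1)
        (fun p : ℝ × ℝ => ∑' n : ℕ, p.2 ^ n * φ n p.1) Filter.atTop K) ∧
    (∀ lam : ℝ, ∀ x : ℝ, 0 ≤ x →
      (∑' n : ℕ, lam ^ n * φ n x)
        = 1 + lam * ∫ y in Set.Ioc (0 : ℝ) x, (x - y) * (∑' n : ℕ, lam ^ n * φ n y) ∂m) := by
  have : IsFiniteMeasureOnCompacts m := ⟨fun K hK => hm K hK⟩
  have hsum (lam x : ℝ) (hx : 0 ≤ x) : Summable fun n : ℕ => ‖lam ^ n * φ n x‖ :=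
    .of_nonneg_of_le (fun _ => norm_nonneg _)
      (fun n => norm_pow_mul_successive_approximation_le hφ0 hφ n hx le_rfl le_rfl)
      (Real.summable_pow_div_factorial _)
  refine ⟨hsum, fun K hK hKsub => ?_, fun lam x hx => ?_⟩
  · obtain ⟨R, hR⟩ := hK.isBounded.exists_norm_le
    refine tendstoUniformlyOn_tsum_nat
      (Real.summable_pow_div_factorial (R * (m.real (Ioc 0 R) * R))) fun n p hp => ?_
    exact norm_pow_mul_successive_approximation_le hφ0 hφ (X := R) (L := R) n (hKsub hp).1
      ((le_abs_self _).trans ((norm_fst_le p).trans (hR p hp)))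
      ((norm_snd_le p).trans (hR p hp))
  · have hIoc : m (Ioc 0 x) ≠ ⊤ := measure_Ioc_lt_top.ne
    set c := |lam| * (m.real (Ioc 0 x) * x)
    have hswap : HasSum (fun n => ∫ y in Ioc 0 x, (x - y) * (lam ^ n * φ n y) ∂m)
        (∫ y in Ioc 0 x, (x - y) * (∑' n : ℕ, lam ^ n * φ n y) ∂m) := by
      refine hasSum_integral_of_dominated_convergence
        (fun n _ => x * (c ^ n / n.factorial)) (fun n => ?_) (fun n => ?_) ?_ ?_ ?_
      · exact ((stronglyMeasurable_const.sub stronglyMeasurable_id).mul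
          ((stronglyMeasurable_successive_approximation hφ0 hφ n).const_mul _)).aestronglyMeasurable
      · refine ae_restrict_of_forall_mem measurableSet_Ioc fun y hy => ?_
        rw [norm_mul, Real.norm_eq_abs (x - y), abs_of_nonneg (sub_nonneg.2 hy.2)]
        exact mul_le_mul (sub_le_self _ hy.1.le)
          (norm_pow_mul_successive_approximation_le hφ0 hφ n hy.1.le hy.2 le_rfl)
          (norm_nonneg _) hx
      · exact .of_forall fun _ => (Real.summable_pow_div_factorial c).mul_left x
      · exact integrableOn_const hIoc
      · exact ae_restrict_of_forall_mem measurableSet_Ioc fun y hy =>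
          ((hsum lam y hy.1.le).of_norm.hasSum).mul_left _
    rw [(hsum lam x hx).of_norm.tsum_eq_zero_add, hφ0, pow_zero, one_mul, ← hswap.tsum_eq,
      ← tsum_mul_left]
    congr 1
    refine tsum_congr fun n => ?_
    rw [hφ, pow_succ', mul_assoc, ← integral_const_mul]
    simp only [mul_left_comm]
end

section
/- Let (f, D_f) and (g, D_g) be solutions of h'' = λ·h·m in integral form on I = (a,∞) with λ > 0. Suppose lim_{x→∞} f(x) = α₊ ∈ (0,∞), lim_{x→∞} D_f(x) = 0, lim_{x→∞} g(x) = 1, lim_{x→∞} D_g(x) = 0, and g > 0 on (a,∞). Then f(x) D_g(x) − g(x) D_f(x) = 0 for all x ∈ (a,∞), and f = α₊ · g on (a,∞). -/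
open MeasureTheory Filter Set

namespace IsIntegralSolution

variable {m : Measure ℝ} {lam c : ℝ} {f D g Dg : ℝ → ℝ}

theorem mono {S T : Set ℝ} (h : IsIntegralSolution m lam S f D) (hTS : T ⊆ S) :
    IsIntegralSolution m lam T f D :=
  ⟨fun x hx y hy => h.1 x (hTS hx) y (hTS hy), fun x hx y hy => h.2 x (hTS hx) y (hTS hy)⟩

theorem continuousOn (h : IsIntegralSolution m lam (Ici c) f D) {y : ℝ} (hcy : c ≤ y)
    (hD : IntervalIntegrable D volume c y) : ContinuousOn f (Icc c y) := by
  have h1 : ContinuousOn (fun x => f c + ∫ t in c..x, D t) (Icc c y) := by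
    have := intervalIntegral.continuousOn_primitive_interval (μ := volume) (f := D)
      (a := c) (b := y) (by
        rw [uIcc_of_le hcy]
        exact (intervalIntegrable_iff_integrableOn_Icc_of_le hcy).1 hD)
    rw [uIcc_of_le hcy] at this
    exact continuousOn_const.add this
  refine h1.congr fun x hx => ?_
  have := h.1 c self_mem_Ici x hx.1 hx.1
  simp only
  linarith

theorem integrableOn (h : IsIntegralSolution m lam (Ici c) f D) {y : ℝ} (hcy : c ≤ y)
    (hm : m (Icc c y) < ⊤) (hD : IntervalIntegrable D volume c y) :
    IntegrableOn f (Ioc c y) m :=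
  ((h.continuousOn hcy hD).integrableOn_of_subset_isCompact isCompact_Icc measurableSet_Icc
    subset_rfl hm.ne).mono_set Ioc_subset_Icc_self

theorem intervalIntegrable (h : IsIntegralSolution m lam (Ici c) f D) {y : ℝ} (hcy : c ≤ y)
    (hf : IntegrableOn f (Ioc c y) m) : IntervalIntegrable D volume c y := by
  have key : ∀ u : ℝ → ℝ, IntegrableOn u (Ioc c y) m → (∀ t, 0 ≤ u t) →
      IntervalIntegrable (fun x => ∫ t in Ioc c x, u t ∂m) volume c y := by
    intro u hu hu0
    refine MonotoneOn.intervalIntegrable ?_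
    rw [uIcc_of_le hcy]
    intro s hs t ht hst
    exact setIntegral_mono_set (hu.mono_set (Ioc_subset_Ioc_right ht.2))
      (Eventually.of_forall hu0) (Ioc_subset_Ioc_right hst).eventuallyLE
  have h1 := key _ hf.pos_part fun t => le_max_right _ _
  have h2 := key _ hf.neg_part fun t => le_max_right _ _
  have h3 := (intervalIntegrable_const (a := c) (b := y) (μ := volume) (c := D c)).add
    ((h1.sub h2).const_mul lam)
  refine h3.congr fun x hx => ?_
  rw [uIoc_of_le hcy] at hx
  have hfx := hf.mono_set (Ioc_subset_Ioc_right hx.2)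
  have e1 := h.2 c self_mem_Ici x hx.1.le hx.1.le
  have e2 := integral_sub hfx.pos_part hfx.neg_part
  have e3 : ∀ r : ℝ, max r 0 - max (-r) 0 = r := fun r => by
    rcases le_total r 0 with hr | hr
    · rw [max_eq_right hr, max_eq_left (by linarith)]; ring
    · rw [max_eq_left hr, max_eq_right (by linarith)]; ring
  simp only [e3] at e2
  rw [← e2]
  linarith

theorem monotoneOn (h : IsIntegralSolution m lam (Ici c) f D) (hlam : 0 ≤ lam)
    (hf : ∀ x ∈ Ici c, 0 ≤ f x) : MonotoneOn D (Ici c) := by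
  intro x hx y hy hxy
  have e := h.2 x hx y hy hxy
  have : 0 ≤ ∫ t in Ioc x y, f t ∂m :=
    setIntegral_nonneg measurableSet_Ioc fun t ht => hf t (le_trans hx ht.1.le)
  have := mul_nonneg hlam this
  linarith

theorem intervalIntegrable_of_nonneg (h : IsIntegralSolution m lam (Ici c) f D) (hlam : 0 ≤ lam)
    (hf : ∀ x ∈ Ici c, 0 ≤ f x) {y : ℝ} (hcy : c ≤ y) : IntervalIntegrable D volume c y := by
  refine MonotoneOn.intervalIntegrable ((h.monotoneOn hlam hf).mono ?_)
  rw [uIcc_of_le hcy]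
  exact Icc_subset_Ici_self

/-- The second equation alone forces integrability of `f` to the left of a point: otherwise
`D` would be constant there, so `f` would be continuous. -/
theorem exists_integrableOn_Ioc_left {T : ℝ} (h : IsIntegralSolution m lam (Ici c) f D)
    (hcT : c < T) (hm : m (Icc c T) < ⊤) : ∃ x ∈ Ico c T, IntegrableOn f (Ioc x T) m := by
  by_contra! hcon
  refine hcon c ⟨le_rfl, hcT⟩ (h.integrableOn hcT.le hm ?_)
  refine (intervalIntegrable_const (c := D T)).congr fun x hx => ?_
  rw [uIoc_of_le hcT.le] at hx
  rcases hx.2.eq_or_lt with rfl | hxT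
  · rfl
  have e := h.2 x hx.1.le T hcT.le hx.2
  rw [integral_undef (hcon x ⟨hx.1.le, hxT⟩)] at e
  linarith

theorem sub_const_mul (hf : IsIntegralSolution m lam (Ici c) f D)
    (hg : IsIntegralSolution m lam (Ici c) g Dg)
    (hfi : ∀ y, c ≤ y → IntegrableOn f (Ioc c y) m)
    (hgi : ∀ y, c ≤ y → IntegrableOn g (Ioc c y) m) (α : ℝ) :
    IsIntegralSolution m lam (Ici c) (fun x => f x - α * g x) (fun x => D x - α * Dg x) := by
  refine ⟨fun x hx y hy hxy => ?_, fun x hx y hy hxy => ?_⟩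
  · have hsub : uIcc x y ⊆ uIcc c y := by
      rw [uIcc_of_le hxy, uIcc_of_le hy]; exact Icc_subset_Icc_left hx
    have h1 := (hf.intervalIntegrable hy (hfi y hy)).mono_set hsub
    have h2 := (hg.intervalIntegrable hy (hgi y hy)).mono_set hsub
    rw [intervalIntegral.integral_sub h1 (h2.const_mul α), intervalIntegral.integral_const_mul,
      ← hf.1 x hx y hy hxy, ← hg.1 x hx y hy hxy]
    ring
  · have h1 := (hfi y hy).mono_set (Ioc_subset_Ioc_left (b := y) hx)
    have h2 := (hgi y hy).mono_set (Ioc_subset_Ioc_left (b := y) hx)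
    have e := integral_sub h1 (h2.const_mul α)
    rw [integral_const_mul] at e
    rw [e]
    linear_combination (hf.2 x hx y hy hxy) - α * (hg.2 x hx y hy hxy)

/-- Comparison from infinity: a bound `|f| ≤ H * g` integrates twice to bounds on `D` and `f`. -/
theorem abs_le_of_abs_le_mul (hlam : 0 ≤ lam) (hf : IsIntegralSolution m lam (Ici c) f D)
    (hg : IsIntegralSolution m lam (Ici c) g Dg)
    (hgi : ∀ y, c ≤ y → IntegrableOn g (Ioc c y) m)
    (hflim : Tendsto f atTop (nhds 0)) (hDlim : Tendsto D atTop (nhds 0))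
    (hglim : Tendsto g atTop (nhds 1)) (hDglim : Tendsto Dg atTop (nhds 0))
    {H : ℝ} (hH : ∀ x ∈ Ici c, |f x| ≤ H * g x) :
    (∀ x ∈ Ici c, |D x| ≤ H * -Dg x) ∧ ∀ x ∈ Ici c, |f x| ≤ H * (g x - 1) := by
  have hD : ∀ x ∈ Ici c, |D x| ≤ H * -Dg x := by
    intro x hx
    have l1 : Tendsto (fun y => |D y - D x|) atTop (nhds |0 - D x|) := (hDlim.sub_const _).abs
    have l2 : Tendsto (fun y => H * (Dg y - Dg x)) atTop (nhds (H * (0 - Dg x))) :=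
      (hDglim.sub_const _).const_mul H
    have := le_of_tendsto_of_tendsto l1 l2 (by
      filter_upwards [eventually_ge_atTop x] with y hxy
      have hy : c ≤ y := le_trans hx hxy
      have h2 := (hgi y hy).mono_set (Ioc_subset_Ioc_left (b := y) hx)
      rw [hf.2 x hx y hy hxy, hg.2 x hx y hy hxy, abs_mul, abs_of_nonneg hlam]
      have : |∫ t in Ioc x y, f t ∂m| ≤ ∫ t in Ioc x y, H * g t ∂m := by
        rw [← Real.norm_eq_abs]
        refine norm_integral_le_of_norm_le (h2.const_mul H) ?_
        filter_upwards [ae_restrict_mem measurableSet_Ioc] with t ht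
        exact hH t (le_trans hx ht.1.le)
      rw [integral_const_mul] at this
      calc _ ≤ lam * (H * ∫ t in Ioc x y, g t ∂m) := mul_le_mul_of_nonneg_left this hlam
        _ = _ := by ring)
    simpa using this
  refine ⟨hD, fun x hx => ?_⟩
  have l1 : Tendsto (fun y => |f y - f x|) atTop (nhds |0 - f x|) := (hflim.sub_const _).abs
  have l2 : Tendsto (fun y => H * -(g y - g x)) atTop (nhds (H * -(1 - g x))) :=
    (hglim.sub_const _).neg.const_mul H
  have := le_of_tendsto_of_tendsto l1 l2 (by
    filter_upwards [eventually_ge_atTop x] with y hxy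
    have hy : c ≤ y := le_trans hx hxy
    have hsub : uIcc x y ⊆ uIcc c y := by
      rw [uIcc_of_le hxy, uIcc_of_le hy]; exact Icc_subset_Icc_left hx
    have h2 := (hg.intervalIntegrable hy (hgi y hy)).mono_set hsub
    rw [hf.1 x hx y hy hxy, hg.1 x hx y hy hxy, ← intervalIntegral.integral_neg,
      ← intervalIntegral.integral_const_mul, ← Real.norm_eq_abs]
    refine intervalIntegral.norm_integral_le_of_norm_le hxy ?_ (h2.neg.const_mul H)
    exact Eventually.of_forall fun t ht => hD t (le_trans hx ht.1.le))
  simpa using this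

theorem eq_const_mul_of_integrableOn (hlam : 0 ≤ lam) (hf : IsIntegralSolution m lam (Ici c) f D)
    (hg : IsIntegralSolution m lam (Ici c) g Dg) (hm : ∀ y, m (Icc c y) < ⊤)
    (hfi : ∀ y, c ≤ y → IntegrableOn f (Ioc c y) m) (hgnonneg : ∀ x ∈ Ici c, 0 ≤ g x)
    {α : ℝ} (hflim : Tendsto f atTop (nhds α)) (hDlim : Tendsto D atTop (nhds 0))
    (hglim : Tendsto g atTop (nhds 1)) (hDglim : Tendsto Dg atTop (nhds 0)) :
    ∀ x ∈ Ici c, f x = α * g x ∧ D x = α * Dg x := by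
  have hDgi : ∀ y, c ≤ y → IntervalIntegrable Dg volume c y := fun y hy =>
    hg.intervalIntegrable_of_nonneg hlam hgnonneg hy
  have hgi : ∀ y, c ≤ y → IntegrableOn g (Ioc c y) m := fun y hy =>
    hg.integrableOn hy (hm y) (hDgi y hy)
  have hDgmono := hg.monotoneOn hlam hgnonneg
  have hDgle : ∀ x ∈ Ici c, Dg x ≤ 0 := fun x hx =>
    ge_of_tendsto hDglim (by
      filter_upwards [eventually_ge_atTop x] with y hxy
      exact hDgmono hx (le_trans hx hxy) hxy)
  have hganti : ∀ x ∈ Ici c, ∀ y, x ≤ y → g y ≤ g x := by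
    intro x hx y hxy
    have e := hg.1 x hx y (le_trans hx hxy) hxy
    have : 0 ≤ ∫ t in x..y, -Dg t := intervalIntegral.integral_nonneg hxy fun t ht =>
      neg_nonneg.2 (hDgle t (le_trans hx ht.1))
    rw [intervalIntegral.integral_neg] at this
    linarith
  have hg1 : ∀ x ∈ Ici c, 1 ≤ g x := fun x hx =>
    le_of_tendsto hglim (by
      filter_upwards [eventually_ge_atTop x] with y hxy
      exact hganti x hx y hxy)
  set h : ℝ → ℝ := fun x => f x - α * g x with hh
  set Dh : ℝ → ℝ := fun x => D x - α * Dg x with hDh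
  have hsol : IsIntegralSolution m lam (Ici c) h Dh := hf.sub_const_mul hg hfi hgi α
  have hlim : Tendsto h atTop (nhds 0) := by
    simpa using hflim.sub (hglim.const_mul α)
  have hDhlim : Tendsto Dh atTop (nhds 0) := by
    simpa using hDlim.sub (hDglim.const_mul α)
  have hstep := fun {H : ℝ} =>
    hsol.abs_le_of_abs_le_mul hlam hg hgi hlim hDhlim hglim hDglim (H := H)
  obtain ⟨H₀, hH₀, hbound⟩ : ∃ H₀, 0 ≤ H₀ ∧ ∀ x ∈ Ici c, |h x| ≤ H₀ := by
    obtain ⟨M, hM⟩ := eventually_atTop.1 (hlim.abs.eventually_le_const (u := 1) (by simp))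
    have hcM : c ≤ max c M := le_max_left _ _
    have hcont := hsol.continuousOn hcM
      ((hf.intervalIntegrable hcM (hfi _ hcM)).sub ((hDgi _ hcM).const_mul α))
    obtain ⟨B, hB⟩ := isCompact_Icc.exists_bound_of_continuousOn hcont
    refine ⟨max B 1, le_trans zero_le_one (le_max_right _ _), fun x hx => ?_⟩
    rcases le_total x (max c M) with hxM | hxM
    · exact (hB x ⟨hx, hxM⟩).trans (le_max_left _ _)
    · exact (hM x (le_trans (le_max_right _ _) hxM)).trans (le_max_right _ _)
  have hG : 1 ≤ g c := hg1 c self_mem_Ici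
  set q : ℝ := 1 - (g c)⁻¹ with hq
  have hq0 : 0 ≤ q := sub_nonneg.2 (inv_le_one_of_one_le₀ hG)
  have hq1 : q < 1 := by
    have : 0 < (g c)⁻¹ := by positivity
    linarith
  have hiter : ∀ n : ℕ, ∀ x ∈ Ici c, |h x| ≤ q ^ n * H₀ * g x := by
    intro n
    induction n with
    | zero =>
      intro x hx
      have := le_mul_of_one_le_right hH₀ (hg1 x hx)
      simpa using (hbound x hx).trans this
    | succ n ih =>
      intro x hx
      refine ((hstep ih).2 x hx).trans ?_
      have h1 : g x - 1 ≤ q * g x := by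
        have : (g c)⁻¹ * g x ≤ 1 := by
          rw [inv_mul_le_iff₀ (by linarith), mul_one]
          exact hganti c self_mem_Ici x hx
        rw [hq]
        linarith
      calc q ^ n * H₀ * (g x - 1) ≤ q ^ n * H₀ * (q * g x) :=
            mul_le_mul_of_nonneg_left h1 (by positivity)
        _ = _ := by ring
  have hzero : ∀ x ∈ Ici c, |h x| ≤ 0 * g x := by
    intro x hx
    have hpow : Tendsto (fun n : ℕ => q ^ n * H₀ * g x) atTop (nhds (0 * H₀ * g x)) :=
      ((tendsto_pow_atTop_nhds_zero_of_lt_one hq0 hq1).mul_const _).mul_const _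
    have := ge_of_tendsto' hpow fun n => hiter n x hx
    simpa using this
  intro x hx
  have h1 := hzero x hx
  have h2 := (hstep hzero).1 x hx
  rw [zero_mul, abs_nonpos_iff] at h1 h2
  exact ⟨sub_eq_zero.1 h1, sub_eq_zero.1 h2⟩

end IsIntegralSolution

/-- If two solutions `(f, D_f)` and `(g, D_g)` of `h'' = λ·h·m` on `(a,∞)` satisfy
`f → α₊ ∈ (0,∞)`, `D_f → 0`, `g → 1`, `D_g → 0` at infinity, and `g > 0`, then the
Wronskian vanishes identically and `f = α₊ · g` on `(a,∞)`. -/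
theorem integral_solution_proportional
    (m : MeasureTheory.Measure ℝ) (a lam : ℝ) (hlam : 0 < lam)
    (hm : ∀ K : Set ℝ, IsCompact K → K ⊆ Set.Ioi a → m K < ⊤)
    (f Df g Dg : ℝ → ℝ)
    (hf : IsIntegralSolution m lam (Set.Ioi a) f Df)
    (hg : IsIntegralSolution m lam (Set.Ioi a) g Dg)
    (α : ℝ) (hα : 0 < α)
    (hflim : Filter.Tendsto f Filter.atTop (nhds α))
    (hDflim : Filter.Tendsto Df Filter.atTop (nhds 0))
    (hglim : Filter.Tendsto g Filter.atTop (nhds 1))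
    (hDglim : Filter.Tendsto Dg Filter.atTop (nhds 0))
    (hgpos : ∀ x ∈ Set.Ioi a, 0 < g x) :
    (∀ x ∈ Set.Ioi a, f x * Dg x - g x * Df x = 0) ∧
      ∀ x ∈ Set.Ioi a, f x = α * g x := by
  have hm' : ∀ c, a < c → ∀ y, m (Icc c y) < ⊤ := fun c hc y =>
    hm _ isCompact_Icc fun t ht => lt_of_lt_of_le hc ht.1
  have hsub : ∀ c, a < c → Ici c ⊆ Ioi a := fun c hc t ht => lt_of_lt_of_le hc ht
  have hprop : ∀ c, a < c → (∀ y, c ≤ y → IntegrableOn f (Ioc c y) m) →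
      ∀ x ∈ Ici c, f x = α * g x ∧ Df x = α * Dg x := fun c hc hfi =>
    (hf.mono (hsub c hc)).eq_const_mul_of_integrableOn hlam.le (hg.mono (hsub c hc)) (hm' c hc) hfi
      (fun x hx => (hgpos x (hsub c hc hx)).le) hflim hDflim hglim hDglim
  have hgi : ∀ c, a < c → ∀ y, c ≤ y → IntegrableOn g (Ioc c y) m := fun c hc y hy =>
    (hg.mono (hsub c hc)).integrableOn hy (hm' c hc y)
      ((hg.mono (hsub c hc)).intervalIntegrable_of_nonneg hlam.le
        (fun x hx => (hgpos x (hsub c hc hx)).le) hy)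
  set S : Set ℝ := {c | a < c ∧ ∀ y, c ≤ y → IntegrableOn f (Ioc c y) m} with hS
  have hSne : S.Nonempty := by
    obtain ⟨M, hM⟩ := eventually_atTop.1 (hflim.eventually (lt_mem_nhds hα))
    have hc : a < max (a + 1) M := lt_of_lt_of_le (by linarith) (le_max_left _ _)
    refine ⟨max (a + 1) M, hc, fun y hy => ?_⟩
    exact (hf.mono (hsub _ hc)).integrableOn hy (hm' _ hc y)
      ((hf.mono (hsub _ hc)).intervalIntegrable_of_nonneg hlam.le
        (fun x hx => (hM x (le_trans (le_max_right _ _) hx)).le) hy)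
  have hSbdd : BddBelow S := ⟨a, fun c hc => hc.1.le⟩
  have hright : ∀ x, sInf S < x → f x = α * g x ∧ Df x = α * Dg x := by
    intro x hx
    obtain ⟨c, hc, hcx⟩ := exists_lt_of_csInf_lt hSne hx
    exact hprop c hc.1 hc.2 x hcx.le
  have hinf : sInf S = a := by
    refine le_antisymm (not_lt.1 fun haT => ?_) (le_csInf hSne fun c hc => hc.1.le)
    set T := sInf S
    have hT : ∀ y, IntegrableOn f (Ioc T y) m := by
      intro y
      rcases le_total T y with hy | hy
      · refine IntegrableOn.congr_fun ((hgi T haT y hy).const_mul α)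
          (fun x hx => ((hright x hx.1).1).symm) measurableSet_Ioc
      · simp [Ioc_eq_empty_of_le hy]
    obtain ⟨c, hac, hcT⟩ := exists_between haT
    obtain ⟨x, hx, hxi⟩ :=
      (hf.mono (hsub c hac)).exists_integrableOn_Ioc_left hcT (hm' c hac T)
    refine (csInf_le hSbdd (a := x) ⟨lt_of_lt_of_le hac hx.1, fun y _ => ?_⟩).not_gt hx.2
    exact (hxi.union (hT y)).mono_set Ioc_subset_Ioc_union_Ioc
  rw [hinf] at hright
  refine ⟨fun x hx => ?_, fun x hx => (hright x hx).1⟩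
  rw [(hright x hx).1, (hright x hx).2]
  ring
end

section
/- Let m be a nonnegative Borel measure on (a,∞) that is finite on compact subsets of (a,∞), let λ > 0, and suppose ∫_{(r,∞)} (y − r) m(dy) < ∞ for every r ∈ (a,∞). Then there exists a continuous nonincreasing function g : (a,∞) → [1,∞) with lim_{x→∞} g(x) = 1 such that g(x) = 1 + λ ∫_{(x,∞)} (y − x) g(y) m(dy) for every x ∈ (a,∞) (all integrals being finite). -/
open MeasureTheory Filter Set

/-- The integral operator `f ↦ 1 + λ ∫ (y - x)⁺ f(y) m(dy)`. -/
noncomputable def picardMap (m : Measure ℝ) (lam : ℝ) (f : ℝ → ENNReal) (x : ℝ) : ENNReal :=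
  1 + ENNReal.ofReal lam * ∫⁻ y, ENNReal.ofReal (y - x) * f y ∂m

/-- The successive approximations starting from the zero function. -/
noncomputable def picardIterate (m : Measure ℝ) (lam : ℝ) (n : ℕ) : ℝ → ENNReal :=
  (picardMap m lam)^[n] 0

/-- The limit of the successive approximations. -/
noncomputable def picardLimit (m : Measure ℝ) (lam : ℝ) (x : ℝ) : ENNReal :=
  ⨆ n, picardIterate m lam n x

lemma picardMap_antitone (m : Measure ℝ) (lam : ℝ) (f : ℝ → ENNReal) :
    Antitone (picardMap m lam f) := by
  intro x x' h
  unfold picardMap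
  gcongr

lemma picardMap_mono (m : Measure ℝ) (lam : ℝ) : Monotone (picardMap m lam) := by
  intro f f' h x
  unfold picardMap
  gcongr
  exact h _

lemma picardIterate_succ (m : Measure ℝ) (lam : ℝ) (n : ℕ) :
    picardIterate m lam (n + 1) = picardMap m lam (picardIterate m lam n) :=
  Function.iterate_succ_apply' _ _ _

lemma picardIterate_antitone (m : Measure ℝ) (lam : ℝ) (n : ℕ) :
    Antitone (picardIterate m lam n) := by
  cases n with
  | zero => exact antitone_const
  | succ n => rw [picardIterate_succ]; exact picardMap_antitone _ _ _

lemma picardIterate_mono (m : Measure ℝ) (lam : ℝ) : Monotone (picardIterate m lam) :=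
  (picardMap_mono m lam).monotone_iterate_of_le_map bot_le

lemma picardLimit_antitone (m : Measure ℝ) (lam : ℝ) : Antitone (picardLimit m lam) :=
  fun _ _ h => iSup_mono fun n => picardIterate_antitone m lam n h

lemma picardLimit_eq (m : Measure ℝ) (lam : ℝ) (x : ℝ) :
    picardLimit m lam x = picardMap m lam (picardLimit m lam) x := by
  have hshift : picardLimit m lam x = ⨆ n, picardIterate m lam (n + 1) x :=
    (Monotone.iSup_nat_add (fun i j h => picardIterate_mono m lam h x) 1).symm
  have hint : ∫⁻ y, ENNReal.ofReal (y - x) * picardLimit m lam y ∂m =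
      ⨆ n, ∫⁻ y, ENNReal.ofReal (y - x) * picardIterate m lam n y ∂m := by
    simp only [picardLimit, ENNReal.mul_iSup]
    refine lintegral_iSup (fun n => ?_) fun i j h y => ?_
    · exact (by fun_prop : Measurable fun y : ℝ => ENNReal.ofReal (y - x)).mul
        (picardIterate_antitone m lam n).measurable
    · exact mul_le_mul_right (picardIterate_mono m lam h y) _
  rw [hshift, picardMap, hint, ENNReal.mul_iSup, ENNReal.add_iSup]
  exact iSup_congr fun n => by rw [picardIterate_succ, picardMap]

lemma tendsto_lintegral_ofReal_sub_mul {m : Measure ℝ} {f : ℝ → ENNReal} {r : ℝ}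
    {l : Filter ℝ} [l.IsCountablyGenerated] {c : ℝ → ENNReal} (hf : Measurable f)
    (hfin : ∀ y, r < y → f y ≠ ⊤) (hint : ∫⁻ y, ENNReal.ofReal (y - r) * f y ∂m ≠ ⊤)
    (hl : ∀ᶠ x in l, r ≤ x) (hc : ∀ y ≤ r, c y = 0)
    (hlim : ∀ y, Tendsto (fun x => ENNReal.ofReal (y - x)) l (nhds (c y))) :
    Tendsto (fun x => ∫⁻ y, ENNReal.ofReal (y - x) * f y ∂m) l
      (nhds (∫⁻ y, c y * f y ∂m)) := by
  refine tendsto_lintegral_filter_of_dominated_convergence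
    (fun y => ENNReal.ofReal (y - r) * f y) (Eventually.of_forall fun x => ?_)
    (hl.mono fun x hx => Eventually.of_forall fun y => ?_) hint
    (Eventually.of_forall fun y => ?_)
  · exact (by fun_prop : Measurable fun y : ℝ => ENNReal.ofReal (y - x)).mul hf
  · gcongr
  · rcases le_or_gt y r with hy | hy
    · rw [hc y hy, zero_mul]
      refine tendsto_const_nhds.congr' (hl.mono fun x hx => ?_)
      simp [ENNReal.ofReal_of_nonpos (show y - x ≤ 0 by linarith)]
    · exact ENNReal.Tendsto.mul_const (hlim y) (Or.inr (hfin y hy))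

lemma tendsto_ofReal_sub_atTop (y : ℝ) :
    Tendsto (fun x => ENNReal.ofReal (y - x)) atTop (nhds 0) := by
  refine tendsto_const_nhds.congr' ((eventually_ge_atTop y).mono fun x hx => ?_)
  simp [ENNReal.ofReal_of_nonpos (sub_nonpos.2 hx)]

lemma measure_Ioi_lt_top_of_lintegral {m : Measure ℝ} {s r : ℝ} (hsr : s < r)
    (h : ∫⁻ y, ENNReal.ofReal (y - s) ∂m ≠ ⊤) : m (Ioi r) < ⊤ := by
  have hle : m (Ioi r) ≤ m {y | ENNReal.ofReal (r - s) ≤ ENNReal.ofReal (y - s)} :=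
    measure_mono fun y (hy : r < y) => ENNReal.ofReal_le_ofReal (by linarith)
  have hpos : ENNReal.ofReal (r - s) ≠ 0 := by simpa using hsr
  exact (hle.trans (meas_ge_le_lintegral_div (by fun_prop) hpos ENNReal.ofReal_ne_top)).trans_lt
    (ENNReal.div_lt_top h hpos)

/-- Pointwise bound making `2 + 2 exp (K (R - y))` a supersolution for suitable `K`, `R`. -/
lemma sub_mul_supersolution_le {K R x y : ℝ} (hK : 0 < K) :
    (y - x) * (2 + 2 * Real.exp (K * (R - y))) ≤
      2 * max (y - R) 0 + 4 * Real.exp (K * (R - x)) / K := by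
  have h1 : R - x ≤ Real.exp (K * (R - x)) / K := by
    rw [le_div_iff₀ hK]
    linarith [Real.add_one_le_exp (K * (R - x))]
  have h2 : (y - x) * Real.exp (K * (R - y)) ≤ Real.exp (K * (R - x)) / K := by
    have hsplit : Real.exp (K * (R - x)) = Real.exp (K * (y - x)) * Real.exp (K * (R - y)) := by
      rw [← Real.exp_add]; ring_nf
    rw [le_div_iff₀ hK, hsplit]
    nlinarith [Real.add_one_le_exp (K * (y - x)), Real.exp_pos (K * (R - y))]
  have h3 : (y - x) * 2 ≤ (max (y - R) 0 + Real.exp (K * (R - x)) / K) * 2 := by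
    linarith [le_max_left (y - R) 0]
  have h4 : 4 * Real.exp (K * (R - x)) / K = 4 * (Real.exp (K * (R - x)) / K) := by ring
  nlinarith

lemma picardMap_supersolution_le {m : Measure ℝ} {lam K R r x M : ℝ} (hlam : 0 < lam)
    (hK : 0 < K) (hM : 0 ≤ M) (hmM : m (Ioi r) = ENNReal.ofReal M) (hKM : 2 * lam * M ≤ K)
    (hR : ENNReal.ofReal lam * ∫⁻ y, ENNReal.ofReal (y - R) ∂m ≤ ENNReal.ofReal (1 / 2))
    (hx : r ≤ x) {f : ℝ → ENNReal}
    (hf : ∀ y, r ≤ y → f y ≤ ENNReal.ofReal (2 + 2 * Real.exp (K * (R - y)))) :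
    picardMap m lam f x ≤ ENNReal.ofReal (2 + 2 * Real.exp (K * (R - x))) := by
  set E := Real.exp (K * (R - x))
  have hEpos : 0 < E := Real.exp_pos _
  have hpt : ∀ y, ENNReal.ofReal (y - x) * f y ≤ 2 * ENNReal.ofReal (y - R) +
      (Ioi r).indicator (fun _ => ENNReal.ofReal (4 * E / K)) y := by
    intro y
    rcases le_or_gt y x with hy | hy
    · rw [ENNReal.ofReal_of_nonpos (by linarith), zero_mul]
      exact zero_le
    · rw [indicator_of_mem (show y ∈ Ioi r from hx.trans_lt hy)]
      calc ENNReal.ofReal (y - x) * f y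
          ≤ ENNReal.ofReal (y - x) * ENNReal.ofReal (2 + 2 * Real.exp (K * (R - y))) := by
            gcongr
            exact hf y (by linarith)
        _ = ENNReal.ofReal ((y - x) * (2 + 2 * Real.exp (K * (R - y)))) :=
            (ENNReal.ofReal_mul (by linarith)).symm
        _ ≤ ENNReal.ofReal (2 * max (y - R) 0 + 4 * E / K) :=
            ENNReal.ofReal_le_ofReal (sub_mul_supersolution_le hK)
        _ = 2 * ENNReal.ofReal (y - R) + ENNReal.ofReal (4 * E / K) := by
            rw [ENNReal.ofReal_add (by positivity) (by positivity),
              ENNReal.ofReal_mul (by norm_num)]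
            simp
  have hint : ∫⁻ y, ENNReal.ofReal (y - x) * f y ∂m ≤
      2 * ∫⁻ y, ENNReal.ofReal (y - R) ∂m + ENNReal.ofReal (4 * E / K * M) := by
    refine (lintegral_mono hpt).trans_eq ?_
    rw [lintegral_add_left (by fun_prop), lintegral_const_mul _ (by fun_prop),
      lintegral_indicator_const measurableSet_Ioi, hmM, ENNReal.ofReal_mul (by positivity)]
  calc picardMap m lam f x
      ≤ 1 + ENNReal.ofReal lam * (2 * ∫⁻ y, ENNReal.ofReal (y - R) ∂m +
          ENNReal.ofReal (4 * E / K * M)) := by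
        unfold picardMap
        gcongr
    _ = 1 + (2 * (ENNReal.ofReal lam * ∫⁻ y, ENNReal.ofReal (y - R) ∂m) +
          ENNReal.ofReal (lam * (4 * E / K * M))) := by
        rw [ENNReal.ofReal_mul hlam.le]; ring
    _ ≤ 1 + (2 * ENNReal.ofReal (1 / 2) + ENNReal.ofReal (lam * (4 * E / K * M))) := by
        gcongr
    _ = ENNReal.ofReal (1 + (2 * (1 / 2) + lam * (4 * E / K * M))) := by
        rw [ENNReal.ofReal_add zero_le_one (by positivity),
          ENNReal.ofReal_add (by norm_num) (by positivity), ENNReal.ofReal_mul zero_le_two]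
        simp
    _ ≤ ENNReal.ofReal (2 + 2 * E) := by
        refine ENNReal.ofReal_le_ofReal ?_
        have h : lam * (4 * E / K * M) ≤ 2 * E := by
          rw [show lam * (4 * E / K * M) = 2 * E * (2 * lam * M) / K by ring, div_le_iff₀ hK]
          gcongr
        linarith

lemma picardLimit_lt_top {m : Measure ℝ} {a lam : ℝ} (hlam : 0 < lam)
    (hmom : ∀ r, a < r → ∫⁻ y, ENNReal.ofReal (y - r) ∂m ≠ ⊤) {r : ℝ} (hr : a < r) :
    picardLimit m lam r < ⊤ := by
  obtain ⟨s, has, hsr⟩ := exists_between hr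
  have hfin := measure_Ioi_lt_top_of_lintegral hsr (hmom s has)
  have hmM : m (Ioi r) = ENNReal.ofReal (m (Ioi r)).toReal :=
    (ENNReal.ofReal_toReal hfin.ne).symm
  have hM : 0 ≤ (m (Ioi r)).toReal := ENNReal.toReal_nonneg
  generalize (m (Ioi r)).toReal = M at hmM hM
  obtain ⟨R, hR⟩ : ∃ R, ENNReal.ofReal lam * ∫⁻ y, ENNReal.ofReal (y - R) ∂m ≤
      ENNReal.ofReal (1 / 2) := by
    have h0 : Tendsto (fun R => ∫⁻ y, ENNReal.ofReal (y - R) ∂m) atTop (nhds 0) := by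
      simpa using tendsto_lintegral_ofReal_sub_mul (m := m) (f := 1) (c := 0) measurable_one
        (by simp) (by simpa using hmom r hr) (eventually_ge_atTop r) (by simp)
        tendsto_ofReal_sub_atTop
    have h1 := ENNReal.Tendsto.const_mul h0 (Or.inr (ENNReal.ofReal_ne_top (r := lam)))
    rw [mul_zero] at h1
    exact (h1.eventually_le_const (by simp)).exists
  have hbound : ∀ n x, r ≤ x → picardIterate m lam n x ≤
      ENNReal.ofReal (2 + 2 * Real.exp ((2 * lam * M + 1) * (R - x))) := by
    intro n
    induction n with
    | zero => intro x _; exact zero_le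
    | succ n ih =>
      intro x hx
      rw [picardIterate_succ]
      exact picardMap_supersolution_le hlam (by positivity) hM hmM (by linarith) hR hx ih
  exact (iSup_le fun n => hbound n r le_rfl).trans_lt ENNReal.ofReal_lt_top

/-- Existence of the normalized positive nonincreasing solution `g` of
`d²g/(dm dx) = λ g` on `(a,∞)` with `g(∞) = 1`, when `∫_{(r,∞)} (y − r) m(dy) < ∞`
for all `r > a`: `g` is continuous, nonincreasing, takes values in `[1,∞)`,
tends to `1` at infinity, and satisfies
`g(x) = 1 + λ ∫_{(x,∞)} (y − x) g(y) m(dy)` with all integrals finite. -/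
theorem exists_normalized_decreasing_solution
    (m : MeasureTheory.Measure ℝ) (a lam : ℝ) (hlam : 0 < lam)
    (hm : ∀ K : Set ℝ, IsCompact K → K ⊆ Set.Ioi a → m K < ⊤)
    (hmom : ∀ r ∈ Set.Ioi a, MeasureTheory.IntegrableOn (fun y => y - r) (Set.Ioi r) m) :
    ∃ g : ℝ → ℝ,
      ContinuousOn g (Set.Ioi a) ∧
      AntitoneOn g (Set.Ioi a) ∧
      (∀ x ∈ Set.Ioi a, 1 ≤ g x) ∧
      Filter.Tendsto g Filter.atTop (nhds 1) ∧
      ∀ x ∈ Set.Ioi a,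
        MeasureTheory.IntegrableOn (fun y => (y - x) * g y) (Set.Ioi x) m ∧
        g x = 1 + lam * ∫ y in Set.Ioi x, (y - x) * g y ∂m := by
  have hmom' : ∀ r, a < r → ∫⁻ y, ENNReal.ofReal (y - r) ∂m ≠ ⊤ := by
    intro r hr
    have hsupp : (fun y => ENNReal.ofReal (y - r)) =
        (Ioi r).indicator fun y => ENNReal.ofReal (y - r) := by
      refine (indicator_eq_self.2 fun y hy => ?_).symm
      simpa using hy
    rw [hsupp, lintegral_indicator measurableSet_Ioi]
    exact (hmom r hr).lintegral_lt_top.ne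
  set G := picardLimit m lam
  have hanti : Antitone G := picardLimit_antitone m lam
  have htop : ∀ x, a < x → G x ≠ ⊤ := fun x hx => (picardLimit_lt_top hlam hmom' hx).ne
  have heq : ∀ x, G x = 1 + ENNReal.ofReal lam * ∫⁻ y, ENNReal.ofReal (y - x) * G y ∂m :=
    picardLimit_eq m lam
  have hint : ∀ x, a < x → ∫⁻ y, ENNReal.ofReal (y - x) * G y ∂m ≠ ⊤ := by
    intro x hx h
    refine htop x hx ?_
    rw [heq, h, ENNReal.mul_top (by simpa using hlam), add_top]
  have hlimG : ∀ {l : Filter ℝ} [l.IsCountablyGenerated] {r : ℝ} {c : ℝ → ENNReal}, a < r →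
      (∀ᶠ x in l, r ≤ x) → (∀ y ≤ r, c y = 0) →
      (∀ y, Tendsto (fun x => ENNReal.ofReal (y - x)) l (nhds (c y))) →
      Tendsto G l (nhds (1 + ENNReal.ofReal lam * ∫⁻ y, c y * G y ∂m)) := by
    intro l _ r c hr hl hc hlim
    refine Tendsto.congr (fun x => (heq x).symm) ?_
    exact (ENNReal.Tendsto.const_mul (tendsto_lintegral_ofReal_sub_mul hanti.measurable
      (fun y hy => htop y (hr.trans hy)) (hint r hr) hl hc hlim)
      (Or.inr ENNReal.ofReal_ne_top)).const_add 1
  refine ⟨fun x => (G x).toReal, ?_, ?_, ?_, ?_, ?_⟩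
  · intro x hx
    obtain ⟨r, har, hrx⟩ := exists_between (show a < x from hx)
    refine ContinuousAt.continuousWithinAt ?_
    refine (ENNReal.tendsto_toReal (htop x hx)).comp ?_
    rw [heq x]
    refine hlimG har (eventually_ge_nhds hrx)
      (fun y hy => ENNReal.ofReal_of_nonpos (by linarith)) fun y => ?_
    exact (ENNReal.continuous_ofReal.comp (continuous_const.sub continuous_id)).tendsto x
  · exact fun x hx y _ hxy => ENNReal.toReal_mono (htop x hx) (hanti hxy)
  · intro x hx
    rw [← ENNReal.toReal_one]
    refine ENNReal.toReal_mono (htop x hx) ?_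
    rw [heq]
    exact le_self_add
  · have h := hlimG (c := 0) (lt_add_one a) (eventually_ge_atTop (a + 1)) (by simp)
      tendsto_ofReal_sub_atTop
    simp only [Pi.zero_apply, zero_mul, lintegral_zero, mul_zero, add_zero] at h
    exact (ENNReal.tendsto_toReal ENNReal.one_ne_top).comp h
  · intro x hx
    have hae : ∀ y ∈ Ioi x, ENNReal.ofReal ((y - x) * (G y).toReal) =
        ENNReal.ofReal (y - x) * G y := by
      intro y hy
      rw [ENNReal.ofReal_mul (sub_nonneg.2 (le_of_lt hy)),
        ENNReal.ofReal_toReal (htop y (lt_trans hx hy))]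
    have hnn : 0 ≤ᵐ[m.restrict (Ioi x)] fun y => (y - x) * (G y).toReal := by
      refine (ae_restrict_mem measurableSet_Ioi).mono fun y hy => ?_
      exact mul_nonneg (sub_nonneg.2 (le_of_lt hy)) ENNReal.toReal_nonneg
    have hmeas : AEStronglyMeasurable (fun y => (y - x) * (G y).toReal)
        (m.restrict (Ioi x)) :=
      ((measurable_id.sub_const x).mul hanti.measurable.ennreal_toReal).aestronglyMeasurable
    have hlint : ∫⁻ y in Ioi x, ENNReal.ofReal ((y - x) * (G y).toReal) ∂m =
        ∫⁻ y, ENNReal.ofReal (y - x) * G y ∂m := by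
      rw [setLIntegral_congr_fun measurableSet_Ioi hae, ← lintegral_indicator measurableSet_Ioi]
      congr 1
      refine indicator_eq_self.2 fun y hy => ?_
      by_contra h
      exact hy (by simp [ENNReal.ofReal_of_nonpos (sub_nonpos.2 (not_lt.1 h))])
    refine ⟨⟨hmeas, (hasFiniteIntegral_iff_ofReal hnn).2 ?_⟩, ?_⟩
    · rw [hlint]
      exact (hint x hx).lt_top
    · rw [integral_eq_lintegral_of_nonneg_ae hnn hmeas, hlint]
      change (G x).toReal = _
      conv_lhs => rw [heq]
      rw [ENNReal.toReal_add ENNReal.one_ne_top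
        (ENNReal.mul_ne_top ENNReal.ofReal_ne_top (hint x hx)), ENNReal.toReal_mul,
        ENNReal.toReal_ofReal hlam.le, ENNReal.toReal_one]
end
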